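/- arXiv:1803.06922 — 3 statements merged into one kernel-verified Lean document; each statement's English description precedes it below -/
import Mathlib

section
/- Let X be a centered d-dimensional Gaussian random vector with non-singular correlation matrix \Sigma, let \mu \in R and let c \in R^d have at least one positive component, with I and L the index sets determined by the quadratic programming problem \Pi_\Sigma(c). If 1 \in L \setminus I, then c_1 = (\Sigma_{I^c I}(\Sigma_{II})^{-1} c_I)_1, and lim_{u \to \infty} E(c,u) = E[(Y - \mu)_+] \in (0,\infty), where Y is a random variable with survival function \bar G(x) = P(X_1 > x | X_I = 0_I) if L = I \cup {1}, and, if N* = L \setminus (I \cup {1}) is non-empty, \bar G(x) = P(X_1 > x, X_{N*} > 0_{N*} | X_I = 0_I) / P(X_{N*} > 0_{N*} | X_I = 0_I), the conditioning being with respect to the Gaussian conditional distribution given X_I = 0_I. -/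
open MeasureTheory ProbabilityTheory Filter Matrix
open scoped Topology ENNReal

noncomputable section

/-- Submatrix of `A` keeping rows with indices in `I` and columns with indices in `J`. -/
def subM {ι : Type*} (A : Matrix ι ι ℝ) (I J : Finset ι) : Matrix ↥I ↥J ℝ :=
  fun i j => A i j

/-- Subvector of `c` keeping the entries with indices in `I`. -/
def subV {ι : Type*} (c : ι → ℝ) (I : Finset ι) : ↥I → ℝ := fun i => c i

/-- Density of a centered Gaussian vector with covariance matrix `S`. -/
def gaussPDF {ι : Type*} [Fintype ι] [DecidableEq ι] (S : Matrix ι ι ℝ) (x : ι → ℝ) : ℝ :=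
  (Real.sqrt ((2 * Real.pi) ^ Fintype.card ι * S.det))⁻¹ *
    Real.exp (-(x ⬝ᵥ S⁻¹.mulVec x) / 2)

/-- `X` is, under `P`, a centered Gaussian random vector with covariance matrix `S`. -/
def IsCenteredGaussianRV {Ω ι : Type*} [MeasurableSpace Ω] [Fintype ι] [DecidableEq ι]
    (P : Measure Ω) (X : Ω → ι → ℝ) (S : Matrix ι ι ℝ) : Prop :=
  Measure.map X P =
    (volume : Measure (ι → ℝ)).withDensity fun x => ENNReal.ofReal (gaussPDF S x)

/-- `bt` is a solution of the quadratic programming problem `Π_A(c)`: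
minimise `x ⬝ Σ⁻¹ x` under `x ≥ c`. -/
def IsQPSol {ι : Type*} [Fintype ι] [DecidableEq ι] (A : Matrix ι ι ℝ) (c bt : ι → ℝ) : Prop :=
  (∀ i, c i ≤ bt i) ∧
    ∀ x : ι → ℝ, (∀ i, c i ≤ x i) → bt ⬝ᵥ A⁻¹.mulVec bt ≤ x ⬝ᵥ A⁻¹.mulVec x

/-- `I` is the index set determined by the quadratic programming problem `Π_A(c)`
with solution `bt`. -/
def IsQPIndex {ι : Type*} [Fintype ι] [DecidableEq ι] (A : Matrix ι ι ℝ)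
    (c bt : ι → ℝ) (I : Finset ι) : Prop :=
  I.Nonempty ∧ (∀ i ∈ I, bt i = c i) ∧
    (∀ i : ↥I, 0 < (subM A I I)⁻¹.mulVec (subV c I) i) ∧
    ∀ j : ι, j ∉ I → bt j = (fun i : ↥I => A j i) ⬝ᵥ (subM A I I)⁻¹.mulVec (subV c I)

/-- `Σ_{i₀,I} (Σ_{II})⁻¹ c_I`. -/
def rowDot {ι : Type*} [Fintype ι] [DecidableEq ι] (A : Matrix ι ι ℝ) (c : ι → ℝ)
    (I : Finset ι) (i0 : ι) : ℝ :=
  (fun i : ↥I => A i0 i) ⬝ᵥ (subM A I I)⁻¹.mulVec (subV c I)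

/-- `c_I ⬝ (Σ_{II})⁻¹ e_{i₀}`. -/
def eDot {ι : Type*} [Fintype ι] [DecidableEq ι] (A : Matrix ι ι ℝ) (c : ι → ℝ)
    (I : Finset ι) (i0 : ι) : ℝ :=
  subV c I ⬝ᵥ (subM A I I)⁻¹.mulVec fun j : ↥I => if (j : ι) = i0 then 1 else 0

/-- Schur complement `Σ_{I^cI^c} - Σ_{I^cI}(Σ_{II})⁻¹Σ_{II^c}`, the covariance matrix of the
conditional Gaussian distribution of `X_{I^c}` given `X_I`. -/
def schurC {ι : Type*} [Fintype ι] [DecidableEq ι] (A : Matrix ι ι ℝ) (I : Finset ι) :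
    Matrix ↥Iᶜ ↥Iᶜ ℝ :=
  subM A Iᶜ Iᶜ - subM A Iᶜ I * (subM A I I)⁻¹ * subM A I Iᶜ

/-- The conditional law of `X_{I^c}` given `X_I = 0`. -/
def condNu {ι : Type*} [Fintype ι] [DecidableEq ι] (A : Matrix ι ι ℝ) (I : Finset ι) :
    Measure (↥Iᶜ → ℝ) :=
  (volume : Measure (↥Iᶜ → ℝ)).withDensity fun y => ENNReal.ofReal (gaussPDF (schurC A I) y)

/-- Survival function `Ḡ(x) = P(X_{i₀} > x, X_{N*} > 0 | X_I = 0) / P(X_{N*} > 0 | X_I = 0)`. -/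
def Gbar {ι : Type*} [Fintype ι] [DecidableEq ι] (A : Matrix ι ι ℝ) (I Nstar : Finset ι)
    (i0 : ι) (x : ℝ) : ℝ :=
  (condNu A I {y : ↥Iᶜ → ℝ | (∀ j : ↥Iᶜ, (j : ι) = i0 → x < y j) ∧
      ∀ j : ↥Iᶜ, (j : ι) ∈ Nstar → 0 < y j}).toReal /
    (condNu A I {y : ↥Iᶜ → ℝ | ∀ j : ↥Iᶜ, (j : ι) ∈ Nstar → 0 < y j}).toReal

/-- `E[(Y - μ)₊]` where `Y` has survival function `Gbar A I Nstar i0`. -/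
def condPlusMean {ι : Type*} [Fintype ι] [DecidableEq ι] (A : Matrix ι ι ℝ)
    (I Nstar : Finset ι) (i0 : ι) (μ : ℝ) : ℝ :=
  (∫ y in {y : ↥Iᶜ → ℝ | ∀ j : ↥Iᶜ, (j : ι) ∈ Nstar → 0 < y j},
      max ((∑ j : ↥Iᶜ, if (j : ι) = i0 then y j else 0) - μ) 0 ∂(condNu A I)) /
    (condNu A I {y : ↥Iᶜ → ℝ | ∀ j : ↥Iᶜ, (j : ι) ∈ Nstar → 0 < y j}).toReal

/-- `E[Y]` where `Y` has survival function `Gbar A I Nstar i0`. -/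
def condMean {ι : Type*} [Fintype ι] [DecidableEq ι] (A : Matrix ι ι ℝ)
    (I Nstar : Finset ι) (i0 : ι) : ℝ :=
  (∫ y in {y : ↥Iᶜ → ℝ | ∀ j : ↥Iᶜ, (j : ι) ∈ Nstar → 0 < y j},
      (∑ j : ↥Iᶜ, if (j : ι) = i0 then y j else 0) ∂(condNu A I)) /
    (condNu A I {y : ↥Iᶜ → ℝ | ∀ j : ↥Iᶜ, (j : ι) ∈ Nstar → 0 < y j}).toReal

/-- The conditioning event `{X_2 > c_2 u, ..., X_d > c_d u}`. -/
def tailEvent {Ω : Type*} {d : ℕ} [NeZero d] (X : Ω → Fin d → ℝ) (c : Fin d → ℝ) (u : ℝ) :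
    Set Ω := {ω | ∀ i : Fin d, i ≠ 0 → c i * u < X ω i}

/-- The marginal mean excess `E(c,u) = E[(X_1 - c_1 u - μ)₊ | X_2 > c_2 u, ..., X_d > c_d u]`. -/
def mmeV {Ω : Type*} [MeasurableSpace Ω] {d : ℕ} [NeZero d] (P : Measure Ω)
    (X : Ω → Fin d → ℝ) (c : Fin d → ℝ) (μ u : ℝ) : ℝ :=
  (∫ ω in tailEvent X c u, max (X ω 0 - c 0 * u - μ) 0 ∂P) / (P (tailEvent X c u)).toReal

/-- The marginal expected shortfall `S(c,u) = E[X_1 | X_2 > c_2 u, ..., X_d > c_d u]`. -/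
def mesV {Ω : Type*} [MeasurableSpace Ω] {d : ℕ} [NeZero d] (P : Measure Ω)
    (X : Ω → Fin d → ℝ) (c : Fin d → ℝ) (u : ℝ) : ℝ :=
  (∫ ω in tailEvent X c u, X ω 0 ∂P) / (P (tailEvent X c u)).toReal

/-- The multivariate conditional tail expectation `M(c,u) = E[X_1 | X > c u]`. -/
def mcteV {Ω : Type*} [MeasurableSpace Ω] {d : ℕ} [NeZero d] (P : Measure Ω)
    (X : Ω → Fin d → ℝ) (c : Fin d → ℝ) (u : ℝ) : ℝ :=
  (∫ ω in {ω | ∀ i, c i * u < X ω i}, X ω 0 ∂P) / (P {ω | ∀ i, c i * u < X ω i}).toReal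

lemma aux_changevar {ι : Type*} [Fintype ι] [DecidableEq ι] (D a : ι → ℝ) (hD : ∀ i, 0 < D i)
    (g : (ι → ℝ) → ℝ) (hg : Measurable g) :
    ∫ x, g x = (∏ i, D i) * ∫ v : ι → ℝ, g (fun i => a i + D i * v i) := by
  have hp : 0 < ∏ i, D i := Finset.prod_pos fun i _ => hD i
  rw [← integral_add_left_eq_self g a]
  have h := Real.smul_map_diagonal_volume_pi (D := D) (by rw [Matrix.det_diagonal]; exact hp.ne')
  rw [← h, integral_smul_measure, h, integral_map, Matrix.det_diagonal,
    ENNReal.toReal_ofReal (abs_nonneg _), abs_of_pos hp, smul_eq_mul]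
  · congr 2
    ext v
    congr 1
    ext i
    simp [Matrix.mulVec_diagonal]
  · exact (LinearMap.continuous_on_pi _).measurable.aemeasurable
  · exact (hg.comp (measurable_const_add a)).aestronglyMeasurable

lemma aux_split {ι : Type*} [Fintype ι] [DecidableEq ι] (I : Finset ι)
    (F : (↥I → ℝ) → ℝ) (G : (↥Iᶜ → ℝ) → ℝ) :
    ∫ v : ι → ℝ, F (fun i => v i) * G (fun i => v i) = (∫ z, F z) * ∫ y, G y := by
  have h1 := volume_preserving_piEquivPiSubtypeProd (fun _ : ι => ℝ) (fun i => i ∈ I)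
  let e : ↥Iᶜ ≃ {i // ¬ i ∈ I} := Equiv.subtypeEquivRight (by simp)
  have h2 := volume_measurePreserving_piCongrLeft (fun _ : {i // ¬ i ∈ I} => ℝ) e
  have h3 : ∫ y, G y = ∫ y : {i // ¬ i ∈ I} → ℝ, G (fun i => y (e i)) := by
    rw [← h2.integral_comp' (g := fun y : {i // ¬ i ∈ I} → ℝ => G (fun i => y (e i)))]
    refine integral_congr_ae (Eventually.of_forall fun y => congrArg G (funext fun i => ?_))
    exact (Equiv.piCongrLeft_apply_apply (fun _ : {i // ¬ i ∈ I} => ℝ) e y i).symm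
  rw [h3, ← integral_prod_mul, ← Measure.volume_eq_prod]
  refine Eq.trans ?_ ((h1.integral_comp' (g := fun z => F z.1 * G fun i => z.2 (e i))).trans ?_)
  · rfl
  · convert rfl
    rfl

lemma aux_pos {ι : Type*} [Fintype ι] (f : (ι → ℝ) → ℝ) (hf : ∀ x, 0 ≤ f x)
    (hi : Integrable f) (U : Set (ι → ℝ)) (hU : IsOpen U) (hne : U.Nonempty)
    (hpos : ∀ x ∈ U, 0 < f x) : 0 < ∫ x, f x := by
  rw [integral_pos_iff_support_of_nonneg hf hi]
  exact (hU.measure_pos volume hne).trans_le (measure_mono fun x hx => (hpos x hx).ne')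

lemma aux_qf_lower {ι : Type*} [Fintype ι] [DecidableEq ι] (A : Matrix ι ι ℝ) (hA : A.PosDef)
    (hcorr : ∀ i, A i i = 1) (x : ι → ℝ) (i : ι) : x i ^ 2 ≤ x ⬝ᵥ A⁻¹ *ᵥ x := by
  have hu : IsUnit A.det := hA.det_pos.ne'.isUnit
  have hsymm : Aᵀ = A := by
    have h := hA.1
    rwa [Matrix.IsHermitian, Matrix.conjTranspose_eq_transpose_of_trivial] at h
  have hs' : (A⁻¹)ᵀ = A⁻¹ := by rw [Matrix.transpose_nonsing_inv, hsymm]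
  set e : ι → ℝ := Pi.single i (x i)
  have h0 := hA.inv.posSemidef.dotProduct_mulVec_nonneg (x - A *ᵥ e)
  have e1 : A⁻¹ *ᵥ (A *ᵥ e) = e := by
    rw [Matrix.mulVec_mulVec, Matrix.nonsing_inv_mul _ hu, Matrix.one_mulVec]
  have e2 : (A *ᵥ e) ⬝ᵥ A⁻¹ *ᵥ x = x i ^ 2 := by
    rw [Matrix.dotProduct_mulVec, ← Matrix.mulVec_transpose, hs', e1]
    simp [e, pow_two]
  have e3 : x ⬝ᵥ e = x i ^ 2 := by simp [e, pow_two]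
  have e4 : (A *ᵥ e) ⬝ᵥ e = x i ^ 2 := by
    simp [e, pow_two, hcorr]
  simp only [star_trivial, Matrix.mulVec_sub, e1, dotProduct_sub, sub_dotProduct, e2, e3, e4] at h0
  linarith

lemma aux_qf_lower_sum {d : ℕ} [NeZero d] (A : Matrix (Fin d) (Fin d) ℝ) (hA : A.PosDef)
    (hcorr : ∀ i, A i i = 1) (x : Fin d → ℝ) :
    (d : ℝ)⁻¹ * ∑ i, x i ^ 2 ≤ x ⬝ᵥ A⁻¹ *ᵥ x := by
  have h := Finset.sum_le_sum fun i (_ : i ∈ Finset.univ) => aux_qf_lower A hA hcorr x i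
  simp only [Finset.sum_const, Finset.card_univ, Fintype.card_fin, nsmul_eq_mul] at h
  have hd : (0 : ℝ) < d := by exact_mod_cast Nat.pos_of_ne_zero (NeZero.ne d)
  rw [inv_mul_le_iff₀ hd]
  exact h

lemma aux_subM_posDef {ι : Type*} [Fintype ι] [DecidableEq ι] (A : Matrix ι ι ℝ)
    (hA : A.PosDef) (I : Finset ι) : (subM A I I).PosDef :=
  hA.submatrix (e := fun i : ↥I => (i : ι)) Subtype.val_injective

lemma aux_sum_split {ι : Type*} [Fintype ι] [DecidableEq ι] (I : Finset ι) (f : ι → ℝ) :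
    ∑ i, f i = (∑ i : ↥I, f i) + ∑ i : ↥Iᶜ, f i := by
  rw [Finset.sum_coe_sort I f, Finset.sum_coe_sort Iᶜ f, Finset.sum_add_sum_compl]

lemma aux_subM_mul {ι : Type*} [Fintype ι] [DecidableEq ι] (A B : Matrix ι ι ℝ)
    (I J K : Finset ι) :
    subM A J I * subM B I K + subM A J Iᶜ * subM B Iᶜ K = subM (A * B) J K := by
  ext i j
  simp only [Matrix.add_apply, Matrix.mul_apply, subM]
  exact (aux_sum_split I fun k => A i k * B k j).symm

lemma aux_schur {ι : Type*} [Fintype ι] [DecidableEq ι] (A : Matrix ι ι ℝ)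
    (hA : A.PosDef) (I : Finset ι) : schurC A I * subM A⁻¹ Iᶜ Iᶜ = 1 := by
  have hu : IsUnit A.det := hA.det_pos.ne'.isUnit
  have huI : IsUnit (subM A I I).det := (aux_subM_posDef A hA I).det_pos.ne'.isUnit
  have hAB : A * A⁻¹ = 1 := Matrix.mul_nonsing_inv _ hu
  have h1 := aux_subM_mul A A⁻¹ I I Iᶜ
  have h2 := aux_subM_mul A A⁻¹ I Iᶜ Iᶜ
  rw [hAB] at h1 h2
  have z1 : subM (1 : Matrix ι ι ℝ) I Iᶜ = 0 := by
    ext i j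
    have : (i : ι) ≠ j := fun h => (Finset.mem_compl.1 j.2) (h ▸ i.2)
    simp [subM, this]
  have z2 : subM (1 : Matrix ι ι ℝ) Iᶜ Iᶜ = 1 := by
    ext i j
    simp [subM, Matrix.one_apply]
  rw [z1] at h1
  rw [z2] at h2
  have h3 : subM A I Iᶜ * subM A⁻¹ Iᶜ Iᶜ = - (subM A I I * subM A⁻¹ I Iᶜ) :=
    eq_neg_of_add_eq_zero_right h1
  rw [schurC, Matrix.sub_mul, Matrix.mul_assoc, Matrix.mul_assoc, h3, Matrix.mul_neg,
    ← Matrix.mul_assoc (subM A I I)⁻¹, Matrix.nonsing_inv_mul _ huI, Matrix.one_mul,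
    Matrix.mul_neg, sub_neg_eq_add, add_comm, h2]

lemma aux_schur_inv {ι : Type*} [Fintype ι] [DecidableEq ι] (A : Matrix ι ι ℝ)
    (hA : A.PosDef) (I : Finset ι) : (schurC A I)⁻¹ = subM A⁻¹ Iᶜ Iᶜ :=
  Matrix.inv_eq_right_inv (aux_schur A hA I)

lemma aux_schur_det {ι : Type*} [Fintype ι] [DecidableEq ι] (A : Matrix ι ι ℝ)
    (hA : A.PosDef) (I : Finset ι) : 0 < (schurC A I).det := by
  have h := congrArg Matrix.det (aux_schur A hA I)
  rw [Matrix.det_mul, Matrix.det_one] at h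
  have h2 := (aux_subM_posDef A⁻¹ hA.inv Iᶜ).det_pos
  by_contra h3
  nlinarith

/-- the dual vector -/
def auxW {ι : Type*} [Fintype ι] [DecidableEq ι] (A : Matrix ι ι ℝ) (c : ι → ℝ)
    (I : Finset ι) (i : ι) : ℝ :=
  if h : i ∈ I then ((subM A I I)⁻¹ *ᵥ subV c I) ⟨i, h⟩ else 0

lemma auxW_spec {ι : Type*} [Fintype ι] [DecidableEq ι] (A : Matrix ι ι ℝ) (hA : A.PosDef)
    (c bt : ι → ℝ) (I : Finset ι) (hI : IsQPIndex A c bt I) :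
    A⁻¹ *ᵥ bt = auxW A c I := by
  have hu : IsUnit A.det := hA.det_pos.ne'.isUnit
  have huI : IsUnit (subM A I I).det := (aux_subM_posDef A hA I).det_pos.ne'.isUnit
  have key : bt = A *ᵥ auxW A c I := by
    ext j
    have h1 : (A *ᵥ auxW A c I) j =
        (fun i : ↥I => A j i) ⬝ᵥ (subM A I I)⁻¹ *ᵥ subV c I := by
      simp only [Matrix.mulVec, dotProduct]
      rw [aux_sum_split I]
      have : ∑ i : ↥Iᶜ, A j i * auxW A c I i = 0 :=
        Finset.sum_eq_zero fun i _ => by simp [auxW, Finset.mem_compl.1 i.2]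
      rw [this, add_zero]
      refine Finset.sum_congr rfl fun i _ => ?_
      simp [auxW, Matrix.mulVec, dotProduct]
    by_cases hj : j ∈ I
    · rw [hI.2.1 j hj, h1]
      have h2 : subM A I I *ᵥ ((subM A I I)⁻¹ *ᵥ subV c I) = subV c I := by
        rw [Matrix.mulVec_mulVec, Matrix.mul_nonsing_inv _ huI, Matrix.one_mulVec]
      exact (congrFun h2 ⟨j, hj⟩).symm
    · rw [hI.2.2.2 j hj, h1]
  rw [key, Matrix.mulVec_mulVec, Matrix.nonsing_inv_mul _ hu, Matrix.one_mulVec]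

lemma auxW_pos {ι : Type*} [Fintype ι] [DecidableEq ι] (A : Matrix ι ι ℝ)
    (c bt : ι → ℝ) (I : Finset ι) (hI : IsQPIndex A c bt I) (i : ι) (hi : i ∈ I) :
    0 < auxW A c I i := by
  simp only [auxW, hi, dif_pos]
  exact hI.2.2.1 ⟨i, hi⟩

lemma auxW_zero {ι : Type*} [Fintype ι] [DecidableEq ι] (A : Matrix ι ι ℝ)
    (c : ι → ℝ) (I : Finset ι) (i : ι) (hi : i ∉ I) : auxW A c I i = 0 := by
  simp [auxW, hi]

lemma aux_qf_restrict {ι : Type*} [Fintype ι] [DecidableEq ι] (B : Matrix ι ι ℝ) (I : Finset ι)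
    (x : ι → ℝ) (hx : ∀ i ∈ I, x i = 0) :
    x ⬝ᵥ B *ᵥ x = (fun i : ↥Iᶜ => x i) ⬝ᵥ subM B Iᶜ Iᶜ *ᵥ (fun i : ↥Iᶜ => x i) := by
  have h : ∀ g : ι → ℝ, (∀ i ∈ I, g i = 0) → ∑ i, g i = ∑ i : ↥Iᶜ, g i := by
    intro g hg
    rw [aux_sum_split I, Finset.sum_eq_zero (fun (i : ↥I) _ => hg i i.2), zero_add]
  simp only [Matrix.mulVec, dotProduct, subM]
  rw [h _ (fun i hi => by simp [hx i hi])]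
  refine Finset.sum_congr rfl fun i _ => ?_
  rw [h _ (fun i hi => by simp [hx i hi])]

/-- one-dimensional exponential factor -/
def auxE (w t : ℝ) : ℝ := (Set.Ioi (0 : ℝ)).indicator (fun t => Real.exp (-w * t)) t

/-- one-dimensional Gaussian factor -/
def auxN (m lam t : ℝ) : ℝ := (|t| + m) * Real.exp (-(lam / 2) * t ^ 2)

lemma auxE_int (w : ℝ) (hw : 0 < w) : Integrable (auxE w) := by
  have := exp_neg_integrableOn_Ioi 0 hw
  rw [← integrable_indicator_iff measurableSet_Ioi] at this
  exact this

lemma auxE_pos (w : ℝ) (hw : 0 < w) : 0 < ∫ t, auxE w t := by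
  rw [integral_pos_iff_support_of_nonneg _ (auxE_int w hw)]
  · refine (isOpen_Ioi.measure_pos volume (Set.nonempty_Ioi (a := (0 : ℝ)))).trans_le
      (measure_mono fun x hx => ?_)
    simp only [Function.mem_support, auxE, Set.indicator_of_mem hx]
    exact (Real.exp_pos _).ne'
  · intro t
    exact Set.indicator_nonneg (fun _ _ => (Real.exp_pos _).le) _

lemma auxN_int (m lam : ℝ) (hl : 0 < lam) : Integrable (auxN m lam) := by
  have h1 := (integrable_mul_exp_neg_mul_sq (half_pos hl)).norm
  have h2 := (integrable_exp_neg_mul_sq (half_pos hl)).const_mul m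
  refine (h1.add h2).congr (Eventually.of_forall fun t => ?_)
  simp [auxN, add_mul, Real.norm_eq_abs]

/-- dominating factor -/
def auxB {ι : Type*} [DecidableEq ι] (w : ι → ℝ) (I : Finset ι) (m lam : ℝ) (i : ι) (t : ℝ) : ℝ :=
  if i ∈ I then auxE (w i) t else auxN m lam t

lemma auxB_int {ι : Type*} [Fintype ι] [DecidableEq ι] (w : ι → ℝ) (I : Finset ι) (m lam : ℝ)
    (hw : ∀ i ∈ I, 0 < w i) (hl : 0 < lam) :
    Integrable (fun v : ι → ℝ => ∏ i, auxB w I m lam i (v i)) := by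
  refine Integrable.fintype_prod (f := fun i => auxB w I m lam i) fun i => ?_
  by_cases hi : i ∈ I
  · convert auxE_int (w i) (hw i hi) using 1
    ext t; simp [auxB, hi]
  · convert auxN_int m lam hl using 1
    ext t; simp [auxB, hi]

lemma aux_bound {ι : Type*} [Fintype ι] [DecidableEq ι] (B : Matrix ι ι ℝ)
    (w : ι → ℝ) (I : Finset ι) (m lam : ℝ) (hm : 1 ≤ m) (hl : 0 < lam)
    (hB : ∀ x : ι → ℝ, lam * ∑ i, x i ^ 2 ≤ x ⬝ᵥ B *ᵥ x)
    (hw0 : ∀ i, i ∉ I → w i = 0)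
    (h : ℝ → ℝ) (hh : ∀ t, |h t| ≤ |t| + m) (i0 : ι) (hi0 : i0 ∉ I) (v x : ι → ℝ)
    (hv : ∀ i ∈ I, 0 < v i) (hx : ∀ i, i ∉ I → x i = v i) :
    |h (v i0) * Real.exp (-(w ⬝ᵥ v) - (x ⬝ᵥ B *ᵥ x) / 2)| ≤ ∏ i, auxB w I m lam i (v i) := by
  have e1 : ∀ i, auxB w I m lam i (v i) = (if i ∈ I then 1 else |v i| + m) *
      Real.exp (-(w i * v i) + (if i ∈ I then 0 else -(lam / 2) * v i ^ 2)) := by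
    intro i
    by_cases hi : i ∈ I
    · simp [auxB, hi, auxE, hv i hi]
    · simp [auxB, hi, auxN, hw0 i hi]
  simp_rw [e1]
  rw [Finset.prod_mul_distrib, ← Real.exp_sum, abs_mul, abs_of_pos (Real.exp_pos _)]
  have hge : ∀ i, 1 ≤ (if i ∈ I then 1 else |v i| + m) := by
    intro i
    split_ifs
    · exact le_rfl
    · linarith [abs_nonneg (v i)]
  have hP : |h (v i0)| ≤ ∏ i, (if i ∈ I then 1 else |v i| + m) := by
    rw [← Finset.mul_prod_erase _ _ (Finset.mem_univ i0)]
    have h1 : (1 : ℝ) ≤ ∏ i ∈ Finset.univ.erase i0, (if i ∈ I then 1 else |v i| + m) := by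
      calc (1 : ℝ) = ∏ i ∈ Finset.univ.erase i0, (1 : ℝ) := by simp
        _ ≤ _ := Finset.prod_le_prod (fun _ _ => zero_le_one) (fun i _ => hge i)
    have h2 : |h (v i0)| ≤ (if i0 ∈ I then 1 else |v i0| + m) := by
      simpa [hi0] using hh (v i0)
    refine h2.trans (le_mul_of_one_le_right ?_ h1)
    exact zero_le_one.trans (hge i0)
  refine mul_le_mul hP (Real.exp_le_exp.2 ?_) (Real.exp_pos _).le
    ((abs_nonneg _).trans hP)
  rw [Finset.sum_add_distrib, Finset.sum_neg_distrib]
  have h3 := hB x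
  have h4 : -(lam * ∑ i, x i ^ 2) / 2 ≤ ∑ i, (if i ∈ I then 0 else -(lam / 2) * v i ^ 2) := by
    rw [Finset.mul_sum, ← Finset.sum_neg_distrib, Finset.sum_div]
    refine Finset.sum_le_sum fun i _ => ?_
    split_ifs with hi
    · nlinarith [sq_nonneg (x i)]
    · rw [hx i hi]; linarith
  simp only [dotProduct] at h3 ⊢
  linarith

/-- the scaling -/
def auxD {ι : Type*} [DecidableEq ι] (I : Finset ι) (s : ℝ) (i : ι) : ℝ := if i ∈ I then s else 1

/-- kernel on `I^c` -/
def auxG {ι : Type*} [Fintype ι] [DecidableEq ι] (B : Matrix ι ι ℝ) (I N : Finset ι) (i0 : ι)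
    (h : ℝ → ℝ) : (↥Iᶜ → ℝ) → ℝ :=
  {y : ↥Iᶜ → ℝ | ∀ j : ↥Iᶜ, (j : ι) ∈ N → 0 < y j}.indicator fun y =>
    h (∑ j : ↥Iᶜ, if (j : ι) = i0 then y j else 0) *
      Real.exp (-(y ⬝ᵥ subM B Iᶜ Iᶜ *ᵥ y) / 2)

lemma aux_sum_i0 {ι : Type*} [Fintype ι] [DecidableEq ι] (I : Finset ι) (i0 : ι) (hi0 : i0 ∉ I)
    (y : ↥Iᶜ → ℝ) : (∑ j : ↥Iᶜ, if (j : ι) = i0 then y j else 0) =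
      y ⟨i0, Finset.mem_compl.2 hi0⟩ := by
  rw [Finset.sum_eq_single ⟨i0, Finset.mem_compl.2 hi0⟩]
  · simp
  · intro b _ hb
    have : (b : ι) ≠ i0 := fun h => hb (Subtype.ext h)
    simp [this]
  · simp

lemma aux_measSet {ι : Type*} [Fintype ι] (p : ι → Prop) (a b s : ι → ℝ) :
    MeasurableSet {y : ι → ℝ | ∀ j, p j → a j < b j + s j * y j} := by
  simp only [Set.ofPred_forall]
  refine MeasurableSet.iInter fun j => MeasurableSet.iInter fun _ => ?_
  exact measurableSet_lt measurable_const (by fun_prop)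

lemma aux_openSet {ι : Type*} [Fintype ι] (p : ι → Prop) (a : ι → ℝ) :
    IsOpen {y : ι → ℝ | ∀ j, p j → a j < y j} := by
  simp only [Set.ofPred_forall]
  refine isOpen_iInter_of_finite fun j => isOpen_iInter_of_finite fun _ => ?_
  exact isOpen_lt continuous_const (continuous_apply j)

lemma aux_qf_cont {ι : Type*} [Fintype ι] (B : Matrix ι ι ℝ) :
    Continuous fun x : ι → ℝ => x ⬝ᵥ B *ᵥ x := by
  simp only [Matrix.mulVec, dotProduct]
  fun_prop

lemma auxG_int {ι : Type*} [Fintype ι] [DecidableEq ι] (B : Matrix ι ι ℝ)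
    (I N : Finset ι) (m lam : ℝ) (hm : 1 ≤ m) (hl : 0 < lam)
    (hB : ∀ x : ι → ℝ, lam * ∑ i, x i ^ 2 ≤ x ⬝ᵥ B *ᵥ x)
    (h : ℝ → ℝ) (hmeas : Measurable h) (hh : ∀ t, |h t| ≤ |t| + m) (i0 : ι) (hi0 : i0 ∉ I) :
    Integrable (auxG B I N i0 h) := by
  have hb : Integrable (fun y : ↥Iᶜ → ℝ => ∏ j, auxN m lam (y j)) :=
    Integrable.fintype_prod (f := fun _ => auxN m lam) fun i => auxN_int m lam hl
  refine Integrable.indicator ?_ (by simpa using aux_measSet (ι := ↥Iᶜ) (fun j => (j : ι) ∈ N) 0 0 1)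
  refine hb.mono' ?_ (Eventually.of_forall fun y => ?_)
  · refine Measurable.aestronglyMeasurable ?_
    simp_rw [aux_sum_i0 I i0 hi0]
    have := (aux_qf_cont (subM B Iᶜ Iᶜ)).measurable
    fun_prop
  · let v : ι → ℝ := fun i => if hi : i ∈ I then 1 else y ⟨i, Finset.mem_compl.2 hi⟩
    let x : ι → ℝ := fun i => if hi : i ∈ I then 0 else y ⟨i, Finset.mem_compl.2 hi⟩
    have h1 := aux_bound B 0 I m lam hm hl hB (by simp) h hh i0 hi0 v x
      (fun i hi => by simp [v, hi]) (fun i hi => by simp [v, x, hi])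
    have e1 : v i0 = ∑ j : ↥Iᶜ, if (j : ι) = i0 then y j else 0 := by
      rw [aux_sum_i0 I i0 hi0]; simp [v, hi0]
    have e2 : x ⬝ᵥ B *ᵥ x = y ⬝ᵥ subM B Iᶜ Iᶜ *ᵥ y := by
      have : (fun i : ↥Iᶜ => x i) = y := by
        ext i
        simp [x, Finset.mem_compl.1 i.2]
      rw [aux_qf_restrict B I x (fun i hi => by simp [x, hi]), this]
    have e3 : ∏ i, auxB 0 I m lam i (v i) = ∏ j : ↥Iᶜ, auxN m lam (y j) := by
      rw [← Finset.prod_mul_prod_compl I, ← Finset.prod_coe_sort Iᶜ, Finset.prod_eq_one, one_mul]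
      · refine Finset.prod_congr rfl fun j _ => ?_
        simp [auxB, v, Finset.mem_compl.1 j.2]
      · intro i hi
        simp [auxB, auxE, v, hi]
    rw [e1, e2, e3] at h1
    rw [Real.norm_eq_abs]
    convert h1 using 3
    simp [neg_div]

lemma auxG_pos {ι : Type*} [Fintype ι] [DecidableEq ι] (B : Matrix ι ι ℝ)
    (I N : Finset ι) (h : ℝ → ℝ) (i0 : ι) (hi0 : i0 ∉ I) (hi : Integrable (auxG B I N i0 h))
    (h0 : ∀ t, 0 ≤ h t) (a : ℝ) (ha : ∀ t, a < t → 0 < h t) :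
    0 < ∫ y, auxG B I N i0 h y := by
  refine aux_pos _ (fun y => Set.indicator_nonneg
    (fun _ _ => mul_nonneg (h0 _) (Real.exp_pos _).le) _) hi
    {y | ∀ j, True → max a 0 < y j} (aux_openSet _ _) ⟨fun _ => max a 0 + 1, fun j _ => by simp⟩ ?_
  intro y hy
  have hm : y ∈ {y : ↥Iᶜ → ℝ | ∀ j : ↥Iᶜ, (j : ι) ∈ N → 0 < y j} :=
    fun j _ => (le_max_right _ _).trans_lt (hy j trivial)
  rw [auxG, Set.indicator_of_mem hm, aux_sum_i0 I i0 hi0]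
  exact mul_pos (ha _ ((le_max_left _ _).trans_lt (hy _ trivial))) (Real.exp_pos _)

lemma aux_limit_split {ι : Type*} [Fintype ι] [DecidableEq ι] (B : Matrix ι ι ℝ)
    (w : ι → ℝ) (I L : Finset ι) (hw0 : ∀ i, i ∉ I → w i = 0)
    (h : ℝ → ℝ) (i0 : ι) (hi0 : i0 ∉ I) (hIL : I ⊆ L) :
    ∫ v : ι → ℝ, {v : ι → ℝ | ∀ i, i ≠ i0 → i ∈ L → 0 < v i}.indicator (fun v =>
      h (v i0) * Real.exp (-(w ⬝ᵥ v) -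
        ((fun i => auxD I 0 i * v i) ⬝ᵥ B *ᵥ (fun i => auxD I 0 i * v i)) / 2)) v =
    (∏ i : ↥I, ∫ t, auxE (w i) t) * ∫ y, auxG B I (L \ insert i0 I) i0 h y := by
  rw [← integral_fintype_prod_volume_eq_prod (fun i : ↥I => auxE (w i)), ← aux_split I]
  congr 1
  ext v
  have e1 : (fun i => auxD I 0 i * v i) ⬝ᵥ B *ᵥ (fun i => auxD I 0 i * v i) =
      (fun i : ↥Iᶜ => v i) ⬝ᵥ subM B Iᶜ Iᶜ *ᵥ (fun i : ↥Iᶜ => v i) := by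
    have : (fun i : ↥Iᶜ => auxD I 0 i * v i) = fun i : ↥Iᶜ => v i := by
      ext i
      simp [auxD, Finset.mem_compl.1 i.2]
    rw [aux_qf_restrict B I _ (fun i hi => by simp [auxD, hi]), this]
  have e2 : w ⬝ᵥ v = ∑ i : ↥I, w i * v i := by
    simp only [dotProduct]
    rw [aux_sum_split I, Finset.sum_eq_zero (s := (Finset.univ : Finset ↥Iᶜ)), add_zero]
    intro i _
    simp [hw0 i (Finset.mem_compl.1 i.2)]
  by_cases hI : ∀ i ∈ I, 0 < v i
  · have e3 : ∏ i : ↥I, auxE (w i) (v i) = Real.exp (-(w ⬝ᵥ v)) := by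
      rw [e2, ← Finset.sum_neg_distrib, Real.exp_sum]
      refine Finset.prod_congr rfl fun i _ => ?_
      simp [auxE, hI i i.2]
    rw [e3]
    by_cases hN : ∀ j : ↥Iᶜ, (j : ι) ∈ L \ insert i0 I → 0 < v j
    · have hm : v ∈ {v : ι → ℝ | ∀ i, i ≠ i0 → i ∈ L → 0 < v i} := by
        intro i h1 h2
        by_cases h3 : i ∈ I
        · exact hI i h3
        · exact hN ⟨i, Finset.mem_compl.2 h3⟩ (by simp [h1, h2, h3])
      have hm' : (fun j : ↥Iᶜ => v j) ∈
          {y : ↥Iᶜ → ℝ | ∀ j : ↥Iᶜ, (j : ι) ∈ L \ insert i0 I → 0 < y j} := hN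
      rw [Set.indicator_of_mem hm, auxG, Set.indicator_of_mem hm', e1, aux_sum_i0 I i0 hi0,
        sub_eq_add_neg, Real.exp_add, neg_div]
      ring
    · have hm : v ∉ {v : ι → ℝ | ∀ i, i ≠ i0 → i ∈ L → 0 < v i} := by
        intro hv
        refine hN fun j hj => hv j ?_ ?_ <;> simp at hj <;> tauto
      have hm' : (fun j : ↥Iᶜ => v j) ∉
          {y : ↥Iᶜ → ℝ | ∀ j : ↥Iᶜ, (j : ι) ∈ L \ insert i0 I → 0 < y j} := hN
      rw [Set.indicator_of_notMem hm, auxG, Set.indicator_of_notMem hm', mul_zero]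
  · have hm : v ∉ {v : ι → ℝ | ∀ i, i ≠ i0 → i ∈ L → 0 < v i} := by
      intro hv
      exact hI fun i hi => hv i (fun h => hi0 (h ▸ hi)) (hIL hi)
    push Not at hI
    obtain ⟨i, hi, hvi⟩ := hI
    rw [Set.indicator_of_notMem hm, Finset.prod_eq_zero (Finset.mem_univ (⟨i, hi⟩ : ↥I)), zero_mul]
    simp [auxE, hvi]

lemma aux_tendsto {ι : Type*} [Fintype ι] [DecidableEq ι] (B : Matrix ι ι ℝ)
    (w c bt : ι → ℝ) (I L : Finset ι) (m lam : ℝ) (hm : 1 ≤ m) (hl : 0 < lam)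
    (hB : ∀ x : ι → ℝ, lam * ∑ i, x i ^ 2 ≤ x ⬝ᵥ B *ᵥ x)
    (hw : ∀ i ∈ I, 0 < w i) (hw0 : ∀ i, i ∉ I → w i = 0)
    (h : ℝ → ℝ) (hmeas : Measurable h) (hh : ∀ t, |h t| ≤ |t| + m)
    (i0 : ι) (hi0 : i0 ∉ I) (hIL : I ⊆ L) (hc : ∀ i, c i ≤ bt i) (hL : ∀ i, i ∈ L ↔ bt i = c i) :
    Tendsto (fun u : ℝ => ∫ v : ι → ℝ,
      {v : ι → ℝ | ∀ i, i ≠ i0 → c i * u < bt i * u + auxD I u⁻¹ i * v i}.indicator (fun v =>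
      h (v i0) * Real.exp (-(w ⬝ᵥ v) -
        ((fun i => auxD I u⁻¹ i * v i) ⬝ᵥ B *ᵥ (fun i => auxD I u⁻¹ i * v i)) / 2)) v)
    atTop (𝓝 ((∏ i : ↥I, ∫ t, auxE (w i) t) * ∫ y, auxG B I (L \ insert i0 I) i0 h y)) := by
  rw [← aux_limit_split B w I L hw0 h i0 hi0 hIL]
  refine tendsto_integral_filter_of_dominated_convergence
    (fun v => ∏ i, auxB w I m lam i (v i)) ?_ ?_ (auxB_int w I m lam hw hl) ?_
  · refine Eventually.of_forall fun u => Measurable.aestronglyMeasurable ?_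
    refine Measurable.indicator ?_ (aux_measSet _ _ _ _)
    have h1 : Measurable fun v : ι → ℝ =>
        (fun i => auxD I u⁻¹ i * v i) ⬝ᵥ B *ᵥ (fun i => auxD I u⁻¹ i * v i) :=
      ((aux_qf_cont B).comp (by fun_prop)).measurable
    have h2 : Measurable fun v : ι → ℝ => w ⬝ᵥ v := by
      simp only [dotProduct]; fun_prop
    fun_prop
  · filter_upwards [eventually_gt_atTop 0] with u hu
    refine Eventually.of_forall fun v => ?_
    have hpi : ∀ i, 0 ≤ auxB w I m lam i (v i) := by
      intro i
      unfold auxB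
      split_ifs
      · exact Set.indicator_nonneg (fun _ _ => (Real.exp_pos _).le) _
      · exact mul_nonneg (by linarith [abs_nonneg (v i)]) (Real.exp_pos _).le
    by_cases hv : v ∈ {v : ι → ℝ | ∀ i, i ≠ i0 → c i * u < bt i * u + auxD I u⁻¹ i * v i}
    · rw [Set.indicator_of_mem hv, Real.norm_eq_abs]
      refine aux_bound B w I m lam hm hl hB hw0 h hh i0 hi0 v _ ?_ ?_
      · intro i hi
        have h1 := hv i (fun h => hi0 (h ▸ hi))
        rw [(hL i).1 (hIL hi)] at h1
        simp only [auxD, hi, if_true, lt_add_iff_pos_right] at h1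
        exact (mul_pos_iff_of_pos_left (inv_pos.2 hu)).1 h1
      · intro i hi
        simp [auxD, hi]
    · rw [Set.indicator_of_notMem hv, norm_zero]
      exact Finset.prod_nonneg fun i _ => hpi i
  · refine Eventually.of_forall fun v => ?_
    have hset : ∀ᶠ u : ℝ in atTop,
        (v ∈ {v : ι → ℝ | ∀ i, i ≠ i0 → c i * u < bt i * u + auxD I u⁻¹ i * v i} ↔
          v ∈ {v : ι → ℝ | ∀ i, i ≠ i0 → i ∈ L → 0 < v i}) := by
      have h1 : ∀ i, ∀ᶠ u : ℝ in atTop,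
          (c i * u < bt i * u + auxD I u⁻¹ i * v i ↔ (i ∈ L → 0 < v i)) := by
        intro i
        by_cases hiL : i ∈ L
        · filter_upwards [eventually_gt_atTop 0] with u hu
          have hD : 0 < auxD I u⁻¹ i := by
            unfold auxD
            split_ifs
            · exact inv_pos.2 hu
            · exact one_pos
          rw [(hL i).1 hiL]
          simp [hiL, hD]
        · have hiI : i ∉ I := fun h => hiL (hIL h)
          have hlt : 0 < bt i - c i :=
            sub_pos.2 (lt_of_le_of_ne (hc i) fun h => hiL ((hL i).2 h.symm))
          have := (tendsto_id.const_mul_atTop hlt).eventually_gt_atTop (-(v i))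
          filter_upwards [this] with u hu
          simp only [id] at hu
          simp only [hiL, false_imp_iff, iff_true, auxD, hiI, if_false]
          linarith
      refine (eventually_all.2 h1).mono fun u hu => ?_
      exact forall_congr' fun i => imp_congr_right fun _ => hu i
    have hD : Tendsto (fun u : ℝ => fun i => auxD I u⁻¹ i * v i) atTop
        (𝓝 (fun i => auxD I 0 i * v i)) := by
      rw [tendsto_pi_nhds]
      intro i
      by_cases hi : i ∈ I
      · simpa [auxD, hi] using (tendsto_inv_atTop_zero (𝕜 := ℝ)).mul_const (v i)
      · simp [auxD, hi]
    have hq := ((aux_qf_cont B).tendsto _).comp hD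
    by_cases hv : v ∈ {v : ι → ℝ | ∀ i, i ≠ i0 → i ∈ L → 0 < v i}
    · rw [Set.indicator_of_mem hv]
      have : Tendsto (fun u : ℝ => h (v i0) * Real.exp (-(w ⬝ᵥ v) -
        ((fun i => auxD I u⁻¹ i * v i) ⬝ᵥ B *ᵥ (fun i => auxD I u⁻¹ i * v i)) / 2)) atTop
        (𝓝 (h (v i0) * Real.exp (-(w ⬝ᵥ v) -
        ((fun i => auxD I 0 i * v i) ⬝ᵥ B *ᵥ (fun i => auxD I 0 i * v i)) / 2))) :=
        ((Real.continuous_exp.tendsto _).comp ((hq.div_const 2).const_sub _)).const_mul _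
      refine this.congr' ?_
      refine hset.mono fun u hu => ?_
      symm
      exact Set.indicator_of_mem (M := ℝ) (hu.2 hv) _
    · rw [Set.indicator_of_notMem hv]
      refine tendsto_const_nhds.congr' ?_
      refine hset.mono fun u hu => ?_
      symm
      exact Set.indicator_of_notMem (M := ℝ) (fun h => hv (hu.1 h)) _

lemma aux_gauss_meas {ι : Type*} [Fintype ι] [DecidableEq ι] (S : Matrix ι ι ℝ) :
    Measurable (gaussPDF S) := by
  have := (aux_qf_cont S⁻¹).measurable
  unfold gaussPDF
  fun_prop

lemma aux_gauss_nonneg {ι : Type*} [Fintype ι] [DecidableEq ι] (S : Matrix ι ι ℝ) (x : ι → ℝ) :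
    0 ≤ gaussPDF S x :=
  mul_nonneg (inv_nonneg.2 (Real.sqrt_nonneg _)) (Real.exp_pos _).le

lemma aux_withDensity {ι : Type*} [Fintype ι] [DecidableEq ι] (S : Matrix ι ι ℝ)
    (s : Set (ι → ℝ)) (hs : MeasurableSet s) (g : (ι → ℝ) → ℝ) :
    ∫ x in s, g x ∂((volume : Measure (ι → ℝ)).withDensity
      fun x => ENNReal.ofReal (gaussPDF S x)) =
    ∫ x, s.indicator (fun x => g x * gaussPDF S x) x := by
  rw [← integral_indicator hs, integral_withDensity_eq_integral_toReal_smul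
    (aux_gauss_meas S).ennreal_ofReal (Eventually.of_forall fun _ => ENNReal.ofReal_lt_top)]
  congr 1
  ext x
  rw [ENNReal.toReal_ofReal (aux_gauss_nonneg S x)]
  by_cases hx : x ∈ s <;> simp [hx, mul_comm]

lemma aux_condNu {ι : Type*} [Fintype ι] [DecidableEq ι] (A : Matrix ι ι ℝ) (hA : A.PosDef)
    (I N : Finset ι) (i0 : ι) : ∃ C : ℝ, 0 < C ∧ ∀ h : ℝ → ℝ,
    ∫ y in {y : ↥Iᶜ → ℝ | ∀ j : ↥Iᶜ, (j : ι) ∈ N → 0 < y j},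
      h (∑ j : ↥Iᶜ, if (j : ι) = i0 then y j else 0) ∂(condNu A I) =
      C * ∫ y, auxG A⁻¹ I N i0 h y := by
  refine ⟨(Real.sqrt ((2 * Real.pi) ^ Fintype.card ↥Iᶜ * (schurC A I).det))⁻¹, ?_, fun h => ?_⟩
  · have := aux_schur_det A hA I
    have := Real.pi_pos
    positivity
  · rw [condNu, aux_withDensity _ _
      (by simpa using aux_measSet (ι := ↥Iᶜ) (fun j => (j : ι) ∈ N) 0 0 1), ← integral_const_mul]
    congr 1
    ext y
    simp only [auxG, gaussPDF, aux_schur_inv A hA I, Set.indicator_apply]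
    split_ifs
    · ring
    · simp

lemma aux_prelimit {Ω : Type*} [MeasurableSpace Ω] (P : Measure Ω)
    {d : ℕ} [NeZero d] (A : Matrix (Fin d) (Fin d) ℝ) (hA : A.PosDef)
    (X : Ω → Fin d → ℝ) (hX : Measurable X) (hG : IsCenteredGaussianRV P X A)
    (c bt : Fin d → ℝ) (I : Finset (Fin d)) (hI : IsQPIndex A c bt I)
    (h0 : (0 : Fin d) ∉ I) (hb0 : bt 0 = c 0) (u : ℝ) (hu : 0 < u) :
    ∃ C : ℝ, 0 < C ∧ ∀ h : ℝ → ℝ, Measurable h →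
    ∫ ω in tailEvent X c u, h (X ω 0 - c 0 * u) ∂P = C * ∫ v : Fin d → ℝ,
      {v : Fin d → ℝ | ∀ i, i ≠ 0 → c i * u < bt i * u + auxD I u⁻¹ i * v i}.indicator (fun v =>
      h (v 0) * Real.exp (-(auxW A c I ⬝ᵥ v) -
        ((fun i => auxD I u⁻¹ i * v i) ⬝ᵥ A⁻¹ *ᵥ (fun i => auxD I u⁻¹ i * v i)) / 2)) v := by
  have hD : ∀ i, 0 < auxD I u⁻¹ i := by
    intro i
    unfold auxD
    split_ifs
    · exact inv_pos.2 hu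
    · exact one_pos
  have hdet := hA.det_pos
  have hpi := Real.pi_pos
  refine ⟨(∏ i, auxD I u⁻¹ i) * ((Real.sqrt ((2 * Real.pi) ^ Fintype.card (Fin d) * A.det))⁻¹ *
    Real.exp (-(u ^ 2 * (bt ⬝ᵥ auxW A c I)) / 2)), ?_, fun h hmeas => ?_⟩
  · have : 0 < ∏ i, auxD I u⁻¹ i := Finset.prod_pos fun i _ => hD i
    positivity
  have hs : MeasurableSet {x : Fin d → ℝ | ∀ i, i ≠ 0 → c i * u < x i} := by
    simpa using aux_measSet (ι := Fin d) (fun i => i ≠ 0) (fun i => c i * u) 0 1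
  have e1 : ∫ ω in tailEvent X c u, h (X ω 0 - c 0 * u) ∂P =
      ∫ x in {x : Fin d → ℝ | ∀ i, i ≠ 0 → c i * u < x i}, h (x 0 - c 0 * u) ∂(Measure.map X P) := by
    rw [setIntegral_map hs (Measurable.aestronglyMeasurable (by fun_prop)) hX.aemeasurable]
    rfl
  rw [e1, hG, aux_withDensity _ _ hs, aux_changevar (auxD I u⁻¹) (fun i => bt i * u) hD,
    mul_assoc]
  swap
  · have := aux_gauss_meas A
    exact Measurable.indicator (by fun_prop) hs
  refine congrArg (fun r : ℝ => (∏ i, auxD I u⁻¹ i) * r) ?_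
  rw [← integral_const_mul]
  refine integral_congr_ae (Eventually.of_forall fun v => ?_)
  beta_reduce
  have hsymm : Aᵀ = A := by
    have h := hA.1
    rwa [Matrix.IsHermitian, Matrix.conjTranspose_eq_transpose_of_trivial] at h
  have hs' : (A⁻¹)ᵀ = A⁻¹ := by rw [Matrix.transpose_nonsing_inv, hsymm]
  have hspec := auxW_spec A hA c bt I hI
  set x : Fin d → ℝ := fun i => auxD I u⁻¹ i * v i with hx
  have ex : (fun i => bt i * u + auxD I u⁻¹ i * v i) = u • bt + x := by
    ext i; simp [hx, mul_comm]
  have ewx : u * (auxW A c I ⬝ᵥ x) = auxW A c I ⬝ᵥ v := by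
    simp only [dotProduct, Finset.mul_sum, hx]
    refine Finset.sum_congr rfl fun i _ => ?_
    by_cases hi : i ∈ I
    · simp only [auxD, hi, if_true]; field_simp
    · simp [auxW_zero A c I i hi]
  have eq : (u • bt + x) ⬝ᵥ A⁻¹ *ᵥ (u • bt + x) =
      u ^ 2 * (bt ⬝ᵥ auxW A c I) + 2 * (auxW A c I ⬝ᵥ v) + x ⬝ᵥ A⁻¹ *ᵥ x := by
    have e3 : bt ⬝ᵥ A⁻¹ *ᵥ x = auxW A c I ⬝ᵥ x := by
      rw [Matrix.dotProduct_mulVec, ← Matrix.mulVec_transpose, hs', hspec]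
    have e4 : x ⬝ᵥ auxW A c I = auxW A c I ⬝ᵥ x := dotProduct_comm _ _
    simp only [Matrix.mulVec_add, Matrix.mulVec_smul, hspec, dotProduct_add, add_dotProduct,
      smul_dotProduct, dotProduct_smul, smul_eq_mul, e3, e4, ← ewx]
    ring
  have hv0 : bt 0 * u + auxD I u⁻¹ 0 * v 0 - c 0 * u = v 0 := by
    simp [hb0, auxD, h0]
  simp only [Set.indicator_apply, Set.mem_setOf_eq, hv0]
  split_ifs
  · rw [ex, gaussPDF, eq]
    rw [show -(u ^ 2 * (bt ⬝ᵥ auxW A c I) + 2 * (auxW A c I ⬝ᵥ v) + x ⬝ᵥ A⁻¹ *ᵥ x) / 2 =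
      -(u ^ 2 * (bt ⬝ᵥ auxW A c I)) / 2 + (-(auxW A c I ⬝ᵥ v) - (x ⬝ᵥ A⁻¹ *ᵥ x) / 2) by ring,
      Real.exp_add]
    ring
  · simp

/-- Theorem 2.1 ii): if `1 ∈ L \ I`, then `c_1 = (Σ_{I^cI}(Σ_II)⁻¹c_I)_1` and
`lim_{u→∞} E(c,u) = E[(Y-μ)₊] ∈ (0,∞)`, where `Y` has survival function
`Ḡ(x) = P(X_1 > x, X_{N*} > 0 | X_I = 0)/P(X_{N*} > 0 | X_I = 0)` with
`N* = L \ (I ∪ {1})` (so that `Ḡ(x) = P(X_1 > x | X_I = 0)` when `L = I ∪ {1}`). -/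
theorem mme_multivariate_gaussian_case_ii
    {Ω : Type*} [MeasurableSpace Ω] (P : Measure Ω) [IsProbabilityMeasure P]
    {d : ℕ} [NeZero d] (A : Matrix (Fin d) (Fin d) ℝ) (hA : A.PosDef)
    (hcorr : ∀ i, A i i = 1)
    (X : Ω → Fin d → ℝ) (hX : Measurable X) (hG : IsCenteredGaussianRV P X A)
    (μ : ℝ) (c : Fin d → ℝ) (hc : ∃ i, 0 < c i)
    (bt : Fin d → ℝ) (I L : Finset (Fin d))
    (hsol : IsQPSol A c bt) (hI : IsQPIndex A c bt I) (hL : ∀ i, i ∈ L ↔ bt i = c i)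
    (h1LI : (0 : Fin d) ∈ L \ I) :
    c 0 = rowDot A c I 0 ∧
    Tendsto (fun u => mmeV P X c μ u) atTop
      (𝓝 (condPlusMean A I (L \ insert 0 I) 0 μ)) ∧
    0 < condPlusMean A I (L \ insert 0 I) 0 μ := by
  classical
  have h0I : (0 : Fin d) ∉ I := (Finset.mem_sdiff.1 h1LI).2
  have h0L : (0 : Fin d) ∈ L := (Finset.mem_sdiff.1 h1LI).1
  have hb0 : bt 0 = c 0 := (hL 0).1 h0L
  have hIL : I ⊆ L := fun i hi => (hL i).2 (hI.2.1 i hi)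
  have hd : (0 : ℝ) < (d : ℝ)⁻¹ := by
    have : (0 : ℝ) < d := by exact_mod_cast Nat.pos_of_ne_zero (NeZero.ne d)
    positivity
  have hB := aux_qf_lower_sum A hA hcorr
  let h : ℝ → ℝ := fun t => max (t - μ) 0
  let k : ℝ → ℝ := fun _ => 1
  have hm : 1 ≤ |μ| + 1 := by linarith [abs_nonneg μ]
  have hhm : Measurable h := by fun_prop
  have hkm : Measurable k := by fun_prop
  have hhb : ∀ t, |h t| ≤ |t| + (|μ| + 1) := by
    intro t
    rw [abs_of_nonneg (le_max_right _ _)]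
    refine max_le ?_ (by positivity)
    linarith [le_abs_self t, neg_abs_le μ]
  have hkb : ∀ t, |k t| ≤ |t| + (|μ| + 1) := by
    intro t
    simp only [k, abs_one]
    linarith [abs_nonneg t, abs_nonneg μ]
  have hw := auxW_pos A c bt I hI
  have hw0 := auxW_zero A c I
  set N := L \ insert 0 I with hN
  set Z : ℝ := ∏ i : ↥I, ∫ t, auxE (auxW A c I i) t
  have hZ : 0 < Z := Finset.prod_pos fun i _ => auxE_pos _ (hw i i.2)
  have hhi := auxG_int A⁻¹ I N _ _ hm hd hB h hhm hhb 0 h0I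
  have hki := auxG_int A⁻¹ I N _ _ hm hd hB k hkm hkb 0 h0I
  have hGh : 0 < ∫ y, auxG A⁻¹ I N 0 h y :=
    auxG_pos A⁻¹ I N h 0 h0I hhi (fun t => le_max_right _ _) μ
      (fun t ht => lt_max_of_lt_left (sub_pos.2 ht))
  have hGk : 0 < ∫ y, auxG A⁻¹ I N 0 k y :=
    auxG_pos A⁻¹ I N k 0 h0I hki (fun t => zero_le_one) 0 (fun t _ => one_pos)
  have hval : condPlusMean A I N 0 μ =
      (∫ y, auxG A⁻¹ I N 0 h y) / ∫ y, auxG A⁻¹ I N 0 k y := by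
    obtain ⟨C, hC, hCe⟩ := aux_condNu A hA I N 0
    have e1 := hCe h
    have e2 := hCe k
    simp only [k, setIntegral_const, smul_eq_mul, mul_one] at e2
    rw [condPlusMean, ← Measure.real, e2]
    simp only [h] at e1
    rw [e1, mul_div_mul_left _ _ hC.ne']
  refine ⟨?_, ?_, ?_⟩
  · rw [← hb0, hI.2.2.2 0 h0I, rowDot]
  · rw [hval]
    have t1 := aux_tendsto A⁻¹ (auxW A c I) c bt I L _ _ hm hd hB hw hw0 h hhm hhb 0 h0I hIL
      hsol.1 hL
    have t2 := aux_tendsto A⁻¹ (auxW A c I) c bt I L _ _ hm hd hB hw hw0 k hkm hkb 0 h0I hIL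
      hsol.1 hL
    have t3 := t1.div t2 (mul_pos hZ hGk).ne'
    rw [mul_div_mul_left _ _ hZ.ne'] at t3
    refine t3.congr' ?_
    filter_upwards [eventually_gt_atTop 0] with u hu
    obtain ⟨C, hC, hCe⟩ := aux_prelimit P A hA X hX hG c bt I hI h0I hb0 u hu
    have e1 := hCe h hhm
    have e2 := hCe k hkm
    rw [mmeV, ← Measure.real]
    have e3 : P.real (tailEvent X c u) = ∫ ω in tailEvent X c u, k (X ω 0 - c 0 * u) ∂P := by
      simp [k]
    rw [e3, e2]
    simp only [h] at e1 ⊢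
    rw [e1, Pi.div_apply, mul_div_mul_left _ _ hC.ne']
  · rw [hval]
    exact div_pos hGh hGk
end
end

section
/- Let X be a centered d-dimensional Gaussian random vector with non-singular correlation matrix \Sigma, let \mu \in R and let c \in R^d have at least one positive component, with I and L the index sets determined by the quadratic programming problem \Pi_\Sigma(c). If 1 \in L^c, then as u \to \infty, E(c,u) \sim u ( (\Sigma_{I^c I}(\Sigma_{II})^{-1} c_I)_1 - c_1 ); in particular E(c,u) \to \infty. -/
open MeasureTheory ProbabilityTheory Filter Matrix
open scoped Topology ENNReal

noncomputable section

lemma aux_sq_le {d : ℕ} (A : Matrix (Fin d) (Fin d) ℝ) (hA : A.PosDef)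
    (hcorr : ∀ i, A i i = 1) (y : Fin d → ℝ) (i : Fin d) :
    y i ^ 2 ≤ y ⬝ᵥ A⁻¹.mulVec y := by
  have hdet : IsUnit A.det := (Matrix.isUnit_iff_isUnit_det A).1 hA.isUnit
  have hsymm : Aᵀ = A := (by simpa using hA.1 : A.IsSymm)
  obtain ⟨z, hz⟩ : ∃ z, z = A⁻¹.mulVec y := ⟨_, rfl⟩
  have hAz : A.mulVec z = y := by
    rw [hz, Matrix.mulVec_mulVec, Matrix.mul_nonsing_inv _ hdet, Matrix.one_mulVec]
  have h := hA.posSemidef.dotProduct_mulVec_nonneg (z - y i • Pi.single i 1)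
  have e1 : A.mulVec (Pi.single i 1) i = 1 := by simp [hcorr]
  have e2 : z ⬝ᵥ A.mulVec (Pi.single i 1) = y i := by
    rw [Matrix.dotProduct_mulVec, ← Matrix.mulVec_transpose, hsymm, hAz]; simp
  simp only [star_trivial, Matrix.mulVec_sub, Matrix.mulVec_smul, hAz, sub_dotProduct,
    dotProduct_sub, smul_dotProduct, dotProduct_smul, e2, single_one_dotProduct, e1,
    smul_eq_mul] at h
  rw [← hz, dotProduct_comm]
  nlinarith

lemma aux_lam {d : ℕ} (A : Matrix (Fin d) (Fin d) ℝ) (hA : A.PosDef)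
    (c bt : Fin d → ℝ) (I : Finset (Fin d)) (hI : IsQPIndex A c bt I) :
    (∀ i, 0 ≤ A⁻¹.mulVec bt i) ∧ ∀ i, i ∉ I → A⁻¹.mulVec bt i = 0 := by
  obtain ⟨-, h1, h2, h3⟩ := hI
  have hdet : IsUnit A.det := (Matrix.isUnit_iff_isUnit_det A).1 hA.isUnit
  have hS : (subM A I I).PosDef := hA.submatrix (e := fun i : I => (i : Fin d)) Subtype.val_injective
  have hSdet : IsUnit (subM A I I).det := (Matrix.isUnit_iff_isUnit_det _).1 hS.isUnit
  obtain ⟨w, hw⟩ : ∃ w, w = (subM A I I)⁻¹.mulVec (subV c I) := ⟨_, rfl⟩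
  have hSw : (subM A I I).mulVec w = subV c I := by
    rw [hw, Matrix.mulVec_mulVec, Matrix.mul_nonsing_inv _ hSdet, Matrix.one_mulVec]
  rw [← hw] at h2 h3
  let lam : Fin d → ℝ := fun i => if h : i ∈ I then w ⟨i, h⟩ else 0
  have hlam : ∀ j, A.mulVec lam j = ∑ i : I, A j i * w i := by
    intro j
    simp only [Matrix.mulVec, dotProduct, lam]
    rw [← Finset.sum_subset (Finset.subset_univ I), ← Finset.sum_coe_sort I]
    · refine Finset.sum_congr rfl fun i _ => ?_
      simp
    · intro i _ hi; simp [hi]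
  have hAl : A.mulVec lam = bt := by
    funext j
    rw [hlam]
    by_cases hj : j ∈ I
    · rw [h1 j hj]
      exact congrFun hSw ⟨j, hj⟩
    · rw [h3 j hj]; rfl
  have : A⁻¹.mulVec bt = lam := by
    rw [← hAl, Matrix.mulVec_mulVec, Matrix.nonsing_inv_mul _ hdet, Matrix.one_mulVec]
  rw [this]
  refine ⟨fun i => ?_, fun i hi => by simp [lam, hi]⟩
  by_cases hi : i ∈ I
  · simp only [lam, hi, dite_true]; exact (h2 _).le
  · simp [lam, hi]

lemma aux_expand {d : ℕ} (A : Matrix (Fin d) (Fin d) ℝ) (hA : A.PosDef)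
    (b x : Fin d → ℝ) (u : ℝ) :
    x ⬝ᵥ A⁻¹.mulVec x = u ^ 2 * (b ⬝ᵥ A⁻¹.mulVec b) + 2 * u * (A⁻¹.mulVec b ⬝ᵥ (x - u • b))
      + (x - u • b) ⬝ᵥ A⁻¹.mulVec (x - u • b) := by
  have hsymm : (A⁻¹)ᵀ = A⁻¹ := (by simpa using hA.inv.1 : A⁻¹.IsSymm)
  have e : b ⬝ᵥ A⁻¹.mulVec x = A⁻¹.mulVec b ⬝ᵥ x := by
    rw [Matrix.dotProduct_mulVec, ← Matrix.mulVec_transpose, hsymm]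
  have e2 : x ⬝ᵥ A⁻¹.mulVec b = A⁻¹.mulVec b ⬝ᵥ x := dotProduct_comm _ _
  have e3 : A⁻¹.mulVec b ⬝ᵥ b = b ⬝ᵥ A⁻¹.mulVec b := dotProduct_comm _ _
  simp only [Matrix.mulVec_sub, Matrix.mulVec_smul, sub_dotProduct,
    dotProduct_sub, smul_dotProduct, dotProduct_smul, smul_eq_mul, e, e2, e3]
  ring

lemma aux_int {d : ℕ} (b : ℝ) (hb : 0 < b) :
    Integrable (fun y : Fin d → ℝ => Real.exp (-b * ∑ i, y i ^ 2)) := by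
  have := Integrable.fintype_prod (ι := Fin d) (E := ℝ) (f := fun _ t => Real.exp (-b * t ^ 2))
    (μ := fun _ => volume) (fun _ => integrable_exp_neg_mul_sq hb)
  refine this.congr (Eventually.of_forall fun y => ?_)
  simp only [Finset.mul_sum, Real.exp_sum]

lemma aux_int_abs {d : ℕ} (b : ℝ) (hb : 0 < b) (j : Fin d) :
    Integrable (fun y : Fin d → ℝ => |y j| * Real.exp (-b * ∑ i, y i ^ 2)) := by
  refine ((aux_int (d := d) (b / 2) (by positivity)).const_mul (2 / b + 1)).mono'
    (by fun_prop) (Eventually.of_forall fun y => ?_)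
  have hS : y j ^ 2 ≤ ∑ i, y i ^ 2 :=
    Finset.single_le_sum (f := fun i => y i ^ 2) (fun i _ => sq_nonneg _) (Finset.mem_univ j)
  generalize ∑ i, y i ^ 2 = S at hS
  rw [Real.norm_eq_abs, abs_of_nonneg (by positivity)]
  have h1 : -b * S = b / 2 * (- S) + (-(b / 2)) * S := by ring
  have h2 : |y j| ≤ (2 / b + 1) * Real.exp (b / 2 * S) := by
    have h3 : b / 2 * S + 1 ≤ Real.exp (b / 2 * S) := Real.add_one_le_exp _
    have h5 : |y j| ≤ 2 / b + b / 2 * S := by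
      have : b / 2 * |y j| ^ 2 ≤ b / 2 * S := by rw [sq_abs]; gcongr
      have h6 : 2 / b + b / 2 * |y j| ^ 2 - |y j| = 2 / b * ((b / 2 * |y j| - 1/2) ^ 2 + 3 / 4) := by
        field_simp; ring
      have : 0 ≤ 2 / b * ((b / 2 * |y j| - 1/2) ^ 2 + 3 / 4) := by positivity
      linarith
    have h7 : 0 < 2 / b := by positivity
    have hS0 : 0 ≤ S := (sq_nonneg _).trans hS
    have h8 : 1 ≤ Real.exp (b / 2 * S) := Real.one_le_exp (by positivity)
    nlinarith
  calc _ ≤ (2 / b + 1) * Real.exp (b / 2 * S) * Real.exp (-b * S) := by gcongr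
    _ = _ := by rw [mul_assoc, ← Real.exp_add]; ring_nf

lemma aux_sum_le {d : ℕ} [NeZero d] (A : Matrix (Fin d) (Fin d) ℝ) (hA : A.PosDef)
    (hcorr : ∀ i, A i i = 1) (y : Fin d → ℝ) :
    (1 / (d : ℝ)) * ∑ i, y i ^ 2 ≤ y ⬝ᵥ A⁻¹.mulVec y := by
  have hd : (0 : ℝ) < d := by exact_mod_cast Nat.pos_of_ne_zero (NeZero.ne d)
  have : ∑ i, y i ^ 2 ≤ ∑ _i : Fin d, y ⬝ᵥ A⁻¹.mulVec y :=
    Finset.sum_le_sum fun i _ => aux_sq_le A hA hcorr y i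
  simp only [Finset.sum_const, Finset.card_univ, Fintype.card_fin, nsmul_eq_mul] at this
  rw [div_mul_eq_mul_div, div_le_iff₀ hd]
  linarith

lemma aux_cont {d : ℕ} (A : Matrix (Fin d) (Fin d) ℝ) :
    Continuous (fun y : Fin d → ℝ => y ⬝ᵥ A⁻¹.mulVec y) := by
  unfold Matrix.mulVec dotProduct
  fun_prop

lemma aux_pdf_cont {d : ℕ} (A : Matrix (Fin d) (Fin d) ℝ) : Continuous (gaussPDF A) := by
  have := aux_cont A
  unfold gaussPDF
  fun_prop

lemma aux_Z {d : ℕ} (A : Matrix (Fin d) (Fin d) ℝ) (hA : A.PosDef) :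
    0 < (Real.sqrt ((2 * Real.pi) ^ Fintype.card (Fin d) * A.det))⁻¹ := by
  have := hA.det_pos
  positivity

lemma aux_pdf_nonneg {d : ℕ} (A : Matrix (Fin d) (Fin d) ℝ) (x : Fin d → ℝ) :
    0 ≤ gaussPDF A x := by
  unfold gaussPDF; positivity

lemma aux_pdf_le {d : ℕ} [NeZero d] (A : Matrix (Fin d) (Fin d) ℝ) (hA : A.PosDef)
    (hcorr : ∀ i, A i i = 1) (y : Fin d → ℝ) :
    gaussPDF A y ≤ (Real.sqrt ((2 * Real.pi) ^ Fintype.card (Fin d) * A.det))⁻¹ *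
      Real.exp (-(1 / (2 * d : ℝ)) * ∑ i, y i ^ 2) := by
  unfold gaussPDF
  have h := aux_sum_le A hA hcorr y
  have hZ := aux_Z A hA
  gcongr
  have : -(1 / (2 * d : ℝ)) * ∑ i, y i ^ 2 = - (1 / (d : ℝ) * ∑ i, y i ^ 2) / 2 := by
    field_simp
  linarith

lemma aux_pdf_int {d : ℕ} [NeZero d] (A : Matrix (Fin d) (Fin d) ℝ) (hA : A.PosDef)
    (hcorr : ∀ i, A i i = 1) : Integrable (gaussPDF A) := by
  have hd : (0 : ℝ) < d := by exact_mod_cast Nat.pos_of_ne_zero (NeZero.ne d)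
  refine ((aux_int (1 / (2 * d : ℝ)) (by positivity)).const_mul
    (Real.sqrt ((2 * Real.pi) ^ Fintype.card (Fin d) * A.det))⁻¹).mono'
    (aux_pdf_cont A).aestronglyMeasurable (Eventually.of_forall fun y => ?_)
  rw [Real.norm_eq_abs, abs_of_nonneg (aux_pdf_nonneg A y)]
  exact aux_pdf_le A hA hcorr y

lemma aux_pdf_int_abs {d : ℕ} [NeZero d] (A : Matrix (Fin d) (Fin d) ℝ) (hA : A.PosDef)
    (hcorr : ∀ i, A i i = 1) (j : Fin d) : Integrable (fun x => x j * gaussPDF A x) := by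
  have hd : (0 : ℝ) < d := by exact_mod_cast Nat.pos_of_ne_zero (NeZero.ne d)
  have hc := aux_pdf_cont A
  refine ((aux_int_abs (1 / (2 * d : ℝ)) (by positivity) j).const_mul
    (Real.sqrt ((2 * Real.pi) ^ Fintype.card (Fin d) * A.det))⁻¹).mono'
    (Continuous.aestronglyMeasurable (by fun_prop)) (Eventually.of_forall fun y => ?_)
  rw [norm_mul, Real.norm_eq_abs, Real.norm_eq_abs, abs_of_nonneg (aux_pdf_nonneg A y)]
  have := mul_le_mul_of_nonneg_left (aux_pdf_le A hA hcorr y) (abs_nonneg (y j))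
  linarith

def auxK {d : ℕ} [NeZero d] (c : Fin d → ℝ) (u : ℝ) : Set (Fin d → ℝ) :=
  {x | ∀ i : Fin d, i ≠ 0 → c i * u < x i}

lemma auxK_meas {d : ℕ} [NeZero d] (c : Fin d → ℝ) (u : ℝ) : MeasurableSet (auxK c u) := by
  have : auxK c u = ⋂ i : Fin d, ⋂ (_ : i ≠ 0), {x : Fin d → ℝ | c i * u < x i} := by
    ext x; simp [auxK]
  rw [this]
  exact MeasurableSet.iInter fun i => MeasurableSet.iInter fun _ =>
    measurableSet_lt measurable_const (measurable_pi_apply i)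

lemma aux_num {d : ℕ} [NeZero d] (A : Matrix (Fin d) (Fin d) ℝ) (hA : A.PosDef)
    (hcorr : ∀ i, A i i = 1) (c bt : Fin d → ℝ) (I : Finset (Fin d))
    (hI : IsQPIndex A c bt I) (h0 : (0 : Fin d) ∉ I) (ε u : ℝ) (hε : 0 < ε) (hu : 0 < u) :
    ∫ x in auxK c u, |x 0 - u * bt 0| * gaussPDF A x ≤
      ε * u * (∫ x in auxK c u, gaussPDF A x) +
      (Real.sqrt ((2 * Real.pi) ^ Fintype.card (Fin d) * A.det))⁻¹ *
        Real.exp (-(u ^ 2 * (bt ⬝ᵥ A⁻¹.mulVec bt)) / 2) * Real.exp (-(ε ^ 2 * u ^ 2) / 4) *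
        ∫ y : Fin d → ℝ, |y 0| * Real.exp (-(1 / (4 * d : ℝ)) * ∑ i, y i ^ 2) := by
  have hd : (0 : ℝ) < d := by exact_mod_cast Nat.pos_of_ne_zero (NeZero.ne d)
  have hZ := aux_Z A hA
  obtain ⟨hl1, hl2⟩ := aux_lam A hA c bt I hI
  have hpi := aux_pdf_int A hA hcorr
  have hpa := aux_pdf_int_abs A hA hcorr 0
  have hg := aux_int_abs (d := d) (1 / (4 * d : ℝ)) (by positivity) 0
  set Z := (Real.sqrt ((2 * Real.pi) ^ Fintype.card (Fin d) * A.det))⁻¹ with hZdef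
  set G : (Fin d → ℝ) → ℝ := fun y => |y 0| * Real.exp (-(1 / (4 * d : ℝ)) * ∑ i, y i ^ 2) with hG
  have hG0 : ∀ y, 0 ≤ G y := fun y => by simp only [hG]; positivity
  have hg' : Integrable (fun x => G (x - u • bt)) := hg.comp_sub_right _
  have e1 : ∫ y, G y = ∫ x, G (x - u • bt) := (integral_sub_right_eq_self G _).symm
  set D := Z * Real.exp (-(u ^ 2 * (bt ⬝ᵥ A⁻¹.mulVec bt)) / 2) * Real.exp (-(ε ^ 2 * u ^ 2) / 4)
    with hD
  have hD0 : 0 < D := by positivity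
  have e2 : ∫ x in auxK c u, G (x - u • bt) ≤ ∫ y, G y := by
    rw [e1]
    exact setIntegral_le_integral hg' (Eventually.of_forall fun x => hG0 _)
  have hint : Integrable (fun x => |x 0 - u * bt 0| * gaussPDF A x) := by
    have := (hpa.sub (hpi.const_mul (u * bt 0))).abs
    refine this.congr (Eventually.of_forall fun x => ?_)
    simp only [Pi.sub_apply]
    rw [← sub_mul, abs_mul, abs_of_nonneg (aux_pdf_nonneg A x)]
  calc ∫ x in auxK c u, |x 0 - u * bt 0| * gaussPDF A x
      ≤ ∫ x in auxK c u, (ε * u * gaussPDF A x + D * G (x - u • bt)) := by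
        refine setIntegral_mono_on hint.integrableOn
          ((hpi.const_mul _).add (hg'.const_mul _)).integrableOn (auxK_meas c u) fun x hx => ?_
        by_cases hy : |x 0 - u * bt 0| ≤ ε * u
        · have := mul_le_mul_of_nonneg_right hy (aux_pdf_nonneg A x)
          have := mul_nonneg hD0.le (hG0 (x - u • bt))
          linarith
        · push Not at hy
          have h1 : 0 ≤ A⁻¹.mulVec bt ⬝ᵥ (x - u • bt) := by
            refine Finset.sum_nonneg fun i _ => ?_
            by_cases hi : i ∈ I
            · refine mul_nonneg (hl1 i) ?_
              have hi0 : i ≠ 0 := fun h => h0 (h ▸ hi)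
              have h3 := hx i hi0
              have h4 := hI.2.1 i hi
              simp only [Pi.sub_apply, Pi.smul_apply, smul_eq_mul, h4]
              linarith
            · simp [hl2 i hi]
          have h2 := aux_expand A hA bt x u
          have h3 := aux_sum_le A hA hcorr (x - u • bt)
          have h4 := aux_sq_le A hA hcorr (x - u • bt) 0
          have e0 : (x - u • bt) 0 = x 0 - u * bt 0 := by simp
          have h5 : gaussPDF A x ≤ D * Real.exp (-(1 / (4 * d : ℝ)) * ∑ i, (x - u • bt) i ^ 2) := by
            simp only [hD, gaussPDF, ← hZdef]
            rw [mul_assoc, mul_assoc, ← Real.exp_add, ← Real.exp_add]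
            gcongr
            have h6 : (ε * u) ^ 2 ≤ (x - u • bt) 0 ^ 2 := by
              rw [e0, ← sq_abs (x 0 - u * bt 0)]
              gcongr
            have h7 : -(1 / (4 * d : ℝ)) * ∑ i, (x - u • bt) i ^ 2 =
              - (1 / (d : ℝ) * ∑ i, (x - u • bt) i ^ 2) / 4 := by
              field_simp
            have h8 : 0 ≤ 2 * u * (A⁻¹.mulVec bt ⬝ᵥ (x - u • bt)) := by positivity
            have h9 : (ε * u) ^ 2 = ε ^ 2 * u ^ 2 := by ring
            rw [h7]
            linarith
          have h6 := mul_le_mul_of_nonneg_left h5 (abs_nonneg (x 0 - u * bt 0))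
          have h7 : 0 ≤ ε * u * gaussPDF A x := by
            have := aux_pdf_nonneg A x
            positivity
          simp only [hG, e0]
          linarith
    _ = ε * u * (∫ x in auxK c u, gaussPDF A x) + D * ∫ x in auxK c u, G (x - u • bt) := by
        rw [integral_add (hpi.const_mul _).integrableOn (hg'.const_mul _).integrableOn,
          integral_const_mul, integral_const_mul]
    _ ≤ _ := by gcongr

lemma aux_den {d : ℕ} [NeZero d] (A : Matrix (Fin d) (Fin d) ℝ) (hA : A.PosDef)
    (hcorr : ∀ i, A i i = 1) (c bt : Fin d → ℝ) (I : Finset (Fin d))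
    (hI : IsQPIndex A c bt I) (hge : ∀ i, c i ≤ bt i) :
    ∃ κ > 0, ∀ u : ℝ, 1 ≤ u →
      (Real.sqrt ((2 * Real.pi) ^ Fintype.card (Fin d) * A.det))⁻¹ *
        Real.exp (-(u ^ 2 * (bt ⬝ᵥ A⁻¹.mulVec bt)) / 2) * κ * (u⁻¹) ^ d ≤
      ∫ x in auxK c u, gaussPDF A x := by
  have hZ := aux_Z A hA
  obtain ⟨hl1, hl2⟩ := aux_lam A hA c bt I hI
  have hpi := aux_pdf_int A hA hcorr
  obtain ⟨M, hM⟩ := (isCompact_Icc (a := (0 : Fin d → ℝ)) (b := 1)).exists_bound_of_continuousOn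
    (aux_cont A).continuousOn
  set Z := (Real.sqrt ((2 * Real.pi) ^ Fintype.card (Fin d) * A.det))⁻¹ with hZdef
  set lam := A⁻¹.mulVec bt with hlam
  refine ⟨Real.exp (-(∑ i, lam i) - M / 2), Real.exp_pos _, fun u hu => ?_⟩
  have hu0 : 0 < u := by linarith
  let B : Set (Fin d → ℝ) := Set.pi Set.univ fun i => Set.Ioo (u * bt i) (u * bt i + u⁻¹)
  have hBm : MeasurableSet B := MeasurableSet.univ_pi fun i => measurableSet_Ioo
  have hBv : volume.real B = (u⁻¹) ^ d := by
    rw [Measure.real, Real.volume_pi_Ioo]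
    simp only [add_sub_cancel_left, Finset.prod_const, Finset.card_univ, Fintype.card_fin,
      ENNReal.toReal_pow]
    rw [ENNReal.toReal_ofReal (by positivity)]
  have hBfin : volume B ≠ ⊤ := by
    simp only [B, Real.volume_pi_Ioo]
    exact ENNReal.prod_ne_top fun i _ => ENNReal.ofReal_ne_top
  have hBK : B ⊆ auxK c u := by
    intro x hx i _
    have h1 := (hx i trivial).1
    have := mul_le_mul_of_nonneg_right (hge i) hu0.le
    linarith
  have hle : ∀ x ∈ B, Z * Real.exp (-(u ^ 2 * (bt ⬝ᵥ lam)) / 2) *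
      Real.exp (-(∑ i, lam i) - M / 2) ≤ gaussPDF A x := by
    intro x hx
    have hy : ∀ i, 0 ≤ (x - u • bt) i ∧ (x - u • bt) i ≤ u⁻¹ := by
      intro i
      have h1 := hx i trivial
      simp only [Set.mem_Ioo] at h1
      simp only [Pi.sub_apply, Pi.smul_apply, smul_eq_mul]
      constructor <;> linarith
    have h2 := aux_expand A hA bt x u
    rw [← hlam] at h2
    have h3 := hM (x - u • bt) ⟨fun i => (hy i).1, fun i => (hy i).2.trans (inv_le_one_of_one_le₀ hu)⟩
    have h4 := (le_abs_self _).trans h3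
    have h5 : u * (lam ⬝ᵥ (x - u • bt)) ≤ ∑ i, lam i := by
      rw [dotProduct, Finset.mul_sum]
      refine Finset.sum_le_sum fun i _ => ?_
      have h6 : u * (x - u • bt) i ≤ 1 := by
        have := mul_le_mul_of_nonneg_left (hy i).2 hu0.le
        rwa [mul_inv_cancel₀ hu0.ne'] at this
      have := mul_le_mul_of_nonneg_left h6 (hl1 i)
      linarith
    simp only [gaussPDF, ← hZdef]
    rw [mul_assoc, ← Real.exp_add]
    gcongr
    linarith
  calc _ = ∫ x in B, Z * Real.exp (-(u ^ 2 * (bt ⬝ᵥ lam)) / 2) *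
      Real.exp (-(∑ i, lam i) - M / 2) := by
        rw [setIntegral_const, hBv, smul_eq_mul, mul_comm]
    _ ≤ ∫ x in B, gaussPDF A x :=
        setIntegral_mono_on (integrableOn_const hBfin) hpi.integrableOn hBm hle
    _ ≤ _ := setIntegral_mono_set hpi.integrableOn
        (Eventually.of_forall fun x => aux_pdf_nonneg A x) hBK.eventuallyLE

lemma aux_mme {Ω : Type*} [MeasurableSpace Ω] (P : Measure Ω) [IsProbabilityMeasure P]
    {d : ℕ} [NeZero d] (A : Matrix (Fin d) (Fin d) ℝ) (hA : A.PosDef)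
    (hcorr : ∀ i, A i i = 1)
    (X : Ω → Fin d → ℝ) (hX : Measurable X) (hG : IsCenteredGaussianRV P X A)
    (μ : ℝ) (c : Fin d → ℝ) (u : ℝ) :
    mmeV P X c μ u = (∫ x in auxK c u, max (x 0 - c 0 * u - μ) 0 * gaussPDF A x) /
      ∫ x in auxK c u, gaussPDF A x := by
  have hK := auxK_meas c u
  have hpi := aux_pdf_int A hA hcorr
  have hm : Measurable fun x => ENNReal.ofReal (gaussPDF A x) :=
    (aux_pdf_cont A).measurable.ennreal_ofReal
  have hT : tailEvent X c u = X ⁻¹' (auxK c u) := rfl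
  unfold mmeV
  rw [hT]
  congr 1
  · rw [← setIntegral_map (f := fun x : Fin d → ℝ => max (x 0 - c 0 * u - μ) 0) hK
      (Continuous.aestronglyMeasurable (by fun_prop)) hX.aemeasurable]
    rw [show Measure.map X P = _ from hG, restrict_withDensity hK,
      integral_withDensity_eq_integral_toReal_smul hm (Eventually.of_forall fun x => by simp)]
    refine integral_congr_ae (Eventually.of_forall fun x => ?_)
    simp only [smul_eq_mul, ENNReal.toReal_ofReal (aux_pdf_nonneg A x)]
    ring
  · rw [← Measure.map_apply hX hK, show Measure.map X P = _ from hG, withDensity_apply _ hK,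
      integral_eq_lintegral_of_nonneg_ae (Eventually.of_forall fun x => aux_pdf_nonneg A x)
      (aux_pdf_cont A).aestronglyMeasurable]

/-- Theorem 2.1 iii): if `1 ∈ L^c`, then as `u → ∞`,
`E(c,u) ~ u((Σ_{I^cI}(Σ_II)⁻¹c_I)_1 - c_1)`; in particular `E(c,u) → ∞`. -/
theorem mme_multivariate_gaussian_case_iii
    {Ω : Type*} [MeasurableSpace Ω] (P : Measure Ω) [IsProbabilityMeasure P]
    {d : ℕ} [NeZero d] (A : Matrix (Fin d) (Fin d) ℝ) (hA : A.PosDef)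
    (hcorr : ∀ i, A i i = 1)
    (X : Ω → Fin d → ℝ) (hX : Measurable X) (hG : IsCenteredGaussianRV P X A)
    (μ : ℝ) (c : Fin d → ℝ) (hc : ∃ i, 0 < c i)
    (bt : Fin d → ℝ) (I L : Finset (Fin d))
    (hsol : IsQPSol A c bt) (hI : IsQPIndex A c bt I) (hL : ∀ i, i ∈ L ↔ bt i = c i)
    (h1Lc : (0 : Fin d) ∉ L) :
    Tendsto (fun u => mmeV P X c μ u / (u * (rowDot A c I 0 - c 0))) atTop (𝓝 1) ∧
    Tendsto (fun u => mmeV P X c μ u) atTop atTop := by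

  have h0L : bt 0 ≠ c 0 := fun h => h1Lc ((hL 0).2 h)
  have h0I : (0 : Fin d) ∉ I := fun h => h0L (hI.2.1 0 h)
  have hrow : rowDot A c I 0 = bt 0 := (hI.2.2.2 0 h0I).symm
  have hb : 0 < bt 0 - c 0 := sub_pos.2 (lt_of_le_of_ne (hsol.1 0) (Ne.symm h0L))
  rw [hrow]
  set b := bt 0 - c 0 with hbdef
  have hZ := aux_Z A hA
  have hpi := aux_pdf_int A hA hcorr
  have hpa := aux_pdf_int_abs A hA hcorr 0
  obtain ⟨κ, hκ, hden⟩ := aux_den A hA hcorr c bt I hI hsol.1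
  set C := ∫ y : Fin d → ℝ, |y 0| * Real.exp (-(1 / (4 * d : ℝ)) * ∑ i, y i ^ 2) with hC
  have hC0 : 0 ≤ C := integral_nonneg fun y => by positivity
  have key : ∀ ε > 0, ∀ u : ℝ, 1 ≤ u →
      |mmeV P X c μ u - u * b| ≤
        |μ| + ε * u + C / κ * (u ^ d * Real.exp (-(ε ^ 2 * u ^ 2) / 4)) := by
    intro ε hε u hu
    have hu0 : 0 < u := by linarith
    have hn := aux_num A hA hcorr c bt I hI h0I ε u hε hu0
    have hdn := hden u hu
    rw [aux_mme P A hA hcorr X hX hG]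
    set Z := (Real.sqrt ((2 * Real.pi) ^ Fintype.card (Fin d) * A.det))⁻¹
    set E := Real.exp (-(u ^ 2 * (bt ⬝ᵥ A⁻¹.mulVec bt)) / 2)
    have hE : 0 < E := Real.exp_pos _
    set F := Real.exp (-(ε ^ 2 * u ^ 2) / 4)
    have hF : 0 < F := Real.exp_pos _
    set D := ∫ x in auxK c u, gaussPDF A x with hD
    have hDpos : 0 < D := lt_of_lt_of_le (by positivity) hdn
    have hint : Integrable (fun x => |x 0 - u * bt 0| * gaussPDF A x) := by
      have := (hpa.sub (hpi.const_mul (u * bt 0))).abs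
      refine this.congr (Eventually.of_forall fun x => ?_)
      simp only [Pi.sub_apply]
      rw [← sub_mul, abs_mul, abs_of_nonneg (aux_pdf_nonneg A x)]
    have hpt : ∀ x : Fin d → ℝ, |max (x 0 - c 0 * u - μ) 0 - u * b| ≤ |x 0 - u * bt 0| + |μ| := by
      intro x
      have h1 : u * b = max (u * b) 0 := (max_eq_left (by positivity)).symm
      rw [h1]
      refine (abs_max_sub_max_le_abs _ _ _).trans ?_
      have : x 0 - c 0 * u - μ - u * b = (x 0 - u * bt 0) - μ := by rw [hbdef]; ring
      rw [this]
      exact abs_sub _ _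
    have hdint : Integrable (fun x => (max (x 0 - c 0 * u - μ) 0 - u * b) * gaussPDF A x) := by
      have hc := aux_pdf_cont A
      refine (hint.add (hpi.const_mul |μ|)).mono' (Continuous.aestronglyMeasurable (by fun_prop))
        (Eventually.of_forall fun x => ?_)
      rw [norm_mul, Real.norm_eq_abs, Real.norm_eq_abs, abs_of_nonneg (aux_pdf_nonneg A x)]
      have := mul_le_mul_of_nonneg_right (hpt x) (aux_pdf_nonneg A x)
      simp only [Pi.add_apply]
      linarith
    have hN : (∫ x in auxK c u, max (x 0 - c 0 * u - μ) 0 * gaussPDF A x) - u * b * D =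
        ∫ x in auxK c u, (max (x 0 - c 0 * u - μ) 0 - u * b) * gaussPDF A x := by
      have h1 : ∫ x in auxK c u, max (x 0 - c 0 * u - μ) 0 * gaussPDF A x =
          ∫ x in auxK c u, ((max (x 0 - c 0 * u - μ) 0 - u * b) * gaussPDF A x +
            u * b * gaussPDF A x) := by
        congr 1; funext x; ring
      rw [h1, integral_add hdint.integrableOn (hpi.const_mul _).integrableOn, integral_const_mul]
      ring
    have hNle : |∫ x in auxK c u, (max (x 0 - c 0 * u - μ) 0 - u * b) * gaussPDF A x| ≤
        (∫ x in auxK c u, |x 0 - u * bt 0| * gaussPDF A x) + |μ| * D := by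
      rw [hD, ← integral_const_mul,
        ← integral_add hint.integrableOn (hpi.const_mul _).integrableOn]
      refine abs_integral_le_integral_abs.trans ?_
      refine integral_mono hdint.abs.integrableOn (hint.add (hpi.const_mul _)).integrableOn
        fun x => ?_
      simp only
      rw [abs_mul, abs_of_nonneg (aux_pdf_nonneg A x), ← add_mul]
      exact mul_le_mul_of_nonneg_right (hpt x) (aux_pdf_nonneg A x)
    have h2 : (∫ x in auxK c u, max (x 0 - c 0 * u - μ) 0 * gaussPDF A x) / D - u * b =
        (∫ x in auxK c u, (max (x 0 - c 0 * u - μ) 0 - u * b) * gaussPDF A x) / D := by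
      rw [← hN]; field_simp
    rw [h2, abs_div, abs_of_pos hDpos, div_le_iff₀ hDpos]
    refine hNle.trans ?_
    have h3 : Z * E * F * C ≤ C / κ * (u ^ d * F) * D := by
      have h4 := mul_le_mul_of_nonneg_left hdn
        (show 0 ≤ C / κ * (u ^ d * F) by positivity)
      refine le_trans (le_of_eq ?_) h4
      rw [inv_pow]
      field_simp
    linarith
  have hexp : ∀ ε > 0, Tendsto (fun u : ℝ => u ^ d * Real.exp (-(ε ^ 2 * u ^ 2) / 4)) atTop (𝓝 0) := by
    intro ε hε
    refine squeeze_zero' ?_ ?_ (Real.tendsto_pow_mul_exp_neg_atTop_nhds_zero d)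
    · filter_upwards [eventually_ge_atTop 0] with u hu
      positivity
    · filter_upwards [eventually_ge_atTop (4 / ε ^ 2), eventually_ge_atTop 0] with u hu hu0
      gcongr
      rw [div_le_iff₀ (by positivity)] at hu
      nlinarith
  have main : Tendsto (fun u => mmeV P X c μ u / (u * b)) atTop (𝓝 1) := by
    rw [Metric.tendsto_nhds]
    intro δ hδ
    have hε : 0 < δ * b / 4 := by positivity
    have h1 : Tendsto (fun u : ℝ => C / κ * (u ^ d * Real.exp (-((δ * b / 4) ^ 2 * u ^ 2) / 4)))
        atTop (𝓝 (C / κ * 0)) := (hexp _ hε).const_mul _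
    rw [mul_zero] at h1
    filter_upwards [h1.eventually_lt_const one_pos, eventually_ge_atTop 1,
      eventually_ge_atTop (4 * |μ| / (δ * b)), eventually_ge_atTop (4 / (δ * b))]
      with u hu1 hu2 hu3 hu4
    have hu0 : 0 < u := by linarith
    have hk := key _ hε u hu2
    have hub : 0 < u * b := by positivity
    rw [Real.dist_eq, div_sub_one hub.ne', abs_div, abs_of_pos hub, div_lt_iff₀ hub]
    rw [div_le_iff₀ (by positivity)] at hu3 hu4
    have : 0 < δ * (u * b) := by positivity
    linarith
  refine ⟨main, ?_⟩
  have h2 : Tendsto (fun u : ℝ => u * b) atTop atTop := tendsto_id.atTop_mul_const hb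
  refine (main.pos_mul_atTop one_pos h2).congr' ?_
  filter_upwards [eventually_gt_atTop 0] with u hu
  have : u * b ≠ 0 := by positivity
  field_simp
end
end

section
/- Let X be a centered d-dimensional Gaussian random vector with non-singular correlation matrix \Sigma and let b = c_{-1} = (c_2,...,c_d) have at least one positive component. Let \mathcal{I} and \mathcal{L} be the index sets corresponding to \Pi_B(b), where B is the covariance matrix of X_{-1}, and suppose \mathcal{I} = {k,...,d-1}. Set I = {k+1,...,d} and c_1 = \Sigma_{1,I}(\Sigma_{II})^{-1} c_I. Then (X_1 - c_1 u) conditional on (X_{-1} > c_{-1} u) converges in distribution, as u \to \infty, to a random variable Y with survival function \bar G(x) = P(X_1 > x | X_I = 0_I) if \mathcal{L} = \mathcal{I}; and if \mathcal{N} = \mathcal{L} \setminus \mathcal{I} is non-empty, then with N* = \mathcal{N} + 1 (the indices in \mathcal{N} shifted by one), \bar G(x) = P(X_1 > x, X_{N*} > 0_{N*} | X_I = 0_I) / P(X_{N*} > 0_{N*} | X_I = 0_I). -/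
open MeasureTheory ProbabilityTheory Filter Matrix
open scoped Topology ENNReal

noncomputable section

/-- The index set `{2,...,d}` of the components of `X_{-1}`. -/
def offFirst (d : ℕ) [NeZero d] : Finset (Fin d) := Finset.univ.filter fun i => i ≠ 0

lemma lint_scale {p : Type*} [Fintype p] (h : (p → ℝ) → ℝ≥0∞) (hh : Measurable h)
    (c : p → ℝ) (u : ℝ) (hu : 0 < u) :
    ENNReal.ofReal (u ^ Fintype.card p) * ∫⁻ a, h a = ∫⁻ z, h (u • c + u⁻¹ • z) := by
  have h1 : ∫⁻ z, h (u • c + u⁻¹ • z) = ∫⁻ z, h (u • c + z) ∂(Measure.map (u⁻¹ • ·) volume) := by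
    exact (lintegral_map (f := fun z => h (u • c + z)) (hh.comp (measurable_const_add _))
      (measurable_const_smul _)).symm
  rw [h1, Measure.map_addHaar_smul _ (inv_ne_zero hu.ne'), lintegral_smul_measure,
    lintegral_add_left_eq_self h]
  simp [abs_of_pos hu]

lemma expDot_fin {p : Type*} [Fintype p] (w : p → ℝ) (hw : ∀ i, 0 < w i) :
    ∫⁻ z in {z : p → ℝ | ∀ i, 0 < z i}, ENNReal.ofReal (Real.exp (-(z ⬝ᵥ w))) ≠ ⊤ := by
  have h1 : Integrable (fun z : p → ℝ => ∏ i, (Set.Ioi (0:ℝ)).indicator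
      (fun t => Real.exp (-(w i) * t)) (z i)) := by
    refine Integrable.fintype_prod (f := fun i => (Set.Ioi (0:ℝ)).indicator
      (fun t => Real.exp (-(w i) * t))) fun i => ?_
    rw [integrable_indicator_iff measurableSet_Ioi]
    exact integrableOn_exp_mul_Ioi (by linarith [hw i]) 0
  have h2 := h1.lintegral_lt_top
  refine ne_of_lt (lt_of_le_of_lt ?_ h2)
  rw [← lintegral_indicator (by measurability)]
  refine lintegral_mono fun z => ?_
  by_cases hz : z ∈ {z : p → ℝ | ∀ i, 0 < z i}
  · rw [Set.indicator_of_mem hz]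
    refine ENNReal.ofReal_le_ofReal (le_of_eq ?_)
    rw [Finset.prod_congr rfl fun i _ => Set.indicator_of_mem (show z i ∈ Set.Ioi 0 from hz i) _,
      ← Real.exp_sum, dotProduct, ← Finset.sum_neg_distrib]
    congr 1
    exact Finset.sum_congr rfl fun i _ => by ring
  · rw [Set.indicator_of_notMem hz]; simp

lemma inner_tendsto {q : Type*} [Fintype q] (g : (q → ℝ) → ℝ≥0∞) (hg : Measurable g)
    (hfin : ∫⁻ y, g y ≠ ⊤) (F : ℝ → Set (q → ℝ)) (F0 : Set (q → ℝ))
    (hF : ∀ u, MeasurableSet (F u)) (hF0 : MeasurableSet F0)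
    (hae : ∀ᵐ y : q → ℝ, ∀ v : q → ℝ, ∀ᶠ u in atTop, (y + (u:ℝ)⁻¹ • v ∈ F u ↔ y ∈ F0))
    (v : q → ℝ) :
    Tendsto (fun u : ℝ => ∫⁻ y, (F u).indicator 1 (y + u⁻¹ • v) * g y) atTop
      (𝓝 (∫⁻ y in F0, g y)) := by
  rw [← lintegral_indicator hF0]
  refine tendsto_lintegral_filter_of_dominated_convergence g ?_ ?_ hfin ?_
  · refine Eventually.of_forall fun u => Measurable.mul ?_ hg
    exact (measurable_one.indicator (hF u)).comp (measurable_add_const _)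
  · refine Eventually.of_forall fun u => Eventually.of_forall fun y => ?_
    by_cases h : y + u⁻¹ • v ∈ F u <;> simp [h]
  · filter_upwards [hae] with y hy
    refine tendsto_const_nhds.congr' ?_
    filter_upwards [hy v] with u hu
    by_cases h : y ∈ F0
    · simp [h, hu.2 h]
    · simp [h, mt hu.1 h]

lemma quad_expand {p : Type*} [Fintype p] (R : Matrix p p ℝ) (hR : R.IsHermitian)
    (c z : p → ℝ) (u : ℝ) (hu : 0 < u) :
    (u • c + u⁻¹ • z) ⬝ᵥ R.mulVec (u • c + u⁻¹ • z) =
      u ^ 2 * (c ⬝ᵥ R.mulVec c) + 2 * (z ⬝ᵥ R.mulVec c) + (u⁻¹) ^ 2 * (z ⬝ᵥ R.mulVec z) := by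
  have hs : c ⬝ᵥ R.mulVec z = z ⬝ᵥ R.mulVec c := by
    have : Rᵀ = R := by simpa [Matrix.IsHermitian, conjTranspose_eq_transpose_of_trivial] using hR
    rw [dotProduct_mulVec, ← mulVec_transpose, this, dotProduct_comm]
  simp only [mulVec_add, mulVec_smul, dotProduct_add, add_dotProduct, smul_dotProduct,
    dotProduct_smul, smul_eq_mul, hs]
  field_simp
  ring

lemma core_tendsto {p q : Type*} [Fintype p] [Fintype q] (R : Matrix p p ℝ)
    (hR : R.IsHermitian) (hR0 : ∀ z, 0 ≤ z ⬝ᵥ R.mulVec z) (K : Matrix q p ℝ)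
    (c : p → ℝ) (hw : ∀ i, 0 < R.mulVec c i)
    (g : (q → ℝ) → ℝ≥0∞) (hg : Measurable g)
    (hfin : ∫⁻ y, g y ≠ ⊤) (F : ℝ → Set (q → ℝ)) (F0 : Set (q → ℝ))
    (hF : ∀ u, MeasurableSet (F u)) (hF0 : MeasurableSet F0)
    (hae : ∀ᵐ y : q → ℝ, ∀ v : q → ℝ, ∀ᶠ u in atTop, (y + (u:ℝ)⁻¹ • v ∈ F u ↔ y ∈ F0)) :
    Tendsto (fun u : ℝ => ENNReal.ofReal (Real.exp (u ^ 2 * (c ⬝ᵥ R.mulVec c) / 2)) *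
        (ENNReal.ofReal (u ^ Fintype.card p) *
        ∫⁻ a, {a : p → ℝ | ∀ i, c i * u < a i}.indicator 1 a *
          ENNReal.ofReal (Real.exp (-(a ⬝ᵥ R.mulVec a) / 2)) *
          ∫⁻ b, (F u).indicator 1 (b - u • K.mulVec c) * g (b - K.mulVec a))) atTop
      (𝓝 ((∫⁻ z in {z : p → ℝ | ∀ i, 0 < z i},
        ENNReal.ofReal (Real.exp (-(z ⬝ᵥ R.mulVec c)))) * ∫⁻ y in F0, g y)) := by
  have hmeasG : ∀ u : ℝ, Measurable fun z : p → ℝ =>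
      ∫⁻ y, (F u).indicator (1 : (q → ℝ) → ℝ≥0∞) (y + K.mulVec z) * g y := by
    intro u
    refine Measurable.lintegral_prod_right' (f := fun x : (p → ℝ) × (q → ℝ) =>
      (F u).indicator (1 : (q → ℝ) → ℝ≥0∞) (x.2 + K.mulVec x.1) * g x.2) ?_
    refine Measurable.mul ?_ (hg.comp measurable_snd)
    refine (measurable_one.indicator (hF u)).comp ?_
    exact (Continuous.add continuous_snd
      (Continuous.matrix_mulVec continuous_const continuous_fst)).measurable
  have hquadm : Measurable fun z : p → ℝ => z ⬝ᵥ R.mulVec z :=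
    (Continuous.dotProduct continuous_id
      (Continuous.matrix_mulVec continuous_const continuous_id)).measurable
  have hdotm : Measurable fun z : p → ℝ => z ⬝ᵥ R.mulVec c :=
    (Continuous.dotProduct continuous_id continuous_const).measurable
  have hpos : MeasurableSet {z : p → ℝ | ∀ i, 0 < z i} := by measurability
  have key : ∀ u : ℝ, 0 < u → ENNReal.ofReal (Real.exp (u ^ 2 * (c ⬝ᵥ R.mulVec c) / 2)) *
        (ENNReal.ofReal (u ^ Fintype.card p) *
        ∫⁻ a, {a : p → ℝ | ∀ i, c i * u < a i}.indicator 1 a *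
          ENNReal.ofReal (Real.exp (-(a ⬝ᵥ R.mulVec a) / 2)) *
          ∫⁻ b, (F u).indicator 1 (b - u • K.mulVec c) * g (b - K.mulVec a)) =
      ∫⁻ z, {z : p → ℝ | ∀ i, 0 < z i}.indicator (fun z =>
        ENNReal.ofReal (Real.exp (-(z ⬝ᵥ R.mulVec c))) *
        ENNReal.ofReal (Real.exp (-((u⁻¹) ^ 2 * (z ⬝ᵥ R.mulVec z)) / 2)) *
        ∫⁻ y, (F u).indicator (1 : (q → ℝ) → ℝ≥0∞) (y + u⁻¹ • K.mulVec z) * g y) z := by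
    intro u hu
    have e1 : ∀ a : p → ℝ, ∫⁻ b, (F u).indicator (1 : (q → ℝ) → ℝ≥0∞) (b - u • K.mulVec c) *
        g (b - K.mulVec a) =
        ∫⁻ y, (F u).indicator (1 : (q → ℝ) → ℝ≥0∞) (y + K.mulVec (a - u • c)) * g y := by
      intro a
      rw [← lintegral_add_right_eq_self _ (K.mulVec a)]
      simp only [add_sub_cancel_right, mulVec_sub, mulVec_smul, add_sub_assoc]
    simp only [e1]
    rw [lint_scale _ _ c u hu, ← lintegral_const_mul']
    · refine lintegral_congr fun z => ?_
      have e2 : (u • c + u⁻¹ • z ∈ {a : p → ℝ | ∀ i, c i * u < a i}) ↔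
          z ∈ {z : p → ℝ | ∀ i, 0 < z i} := by
        refine forall_congr' fun i => ?_
        simp only [Pi.add_apply, Pi.smul_apply, smul_eq_mul, mul_comm u, lt_add_iff_pos_right]
        exact mul_pos_iff_of_pos_left (inv_pos.2 hu)
      by_cases hz : z ∈ {z : p → ℝ | ∀ i, 0 < z i}
      · rw [Set.indicator_of_mem hz, Set.indicator_of_mem (e2.2 hz), add_sub_cancel_left,
          mulVec_smul, Pi.one_apply, one_mul, ← mul_assoc]
        congr 1
        rw [← ENNReal.ofReal_mul (Real.exp_nonneg _), ← ENNReal.ofReal_mul (Real.exp_nonneg _),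
          ← Real.exp_add, ← Real.exp_add, quad_expand R hR c z u hu]
        congr 2
        ring
      · rw [Set.indicator_of_notMem hz, Set.indicator_of_notMem (mt e2.1 hz)]
        simp
    · exact ENNReal.ofReal_ne_top
    · refine Measurable.mul (Measurable.mul ?_ ?_) ?_
      · exact measurable_one.indicator (by measurability)
      · exact (Real.measurable_exp.comp ((hquadm.neg).div_const 2)).ennreal_ofReal
      · exact (hmeasG u).comp (measurable_sub_const _)
  have hZ := expDot_fin _ hw
  rw [← lintegral_mul_const' _ _ (ne_top_of_le_ne_top hfin (setLIntegral_le_lintegral _ _)),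
    ← lintegral_indicator hpos]
  refine Tendsto.congr' (EventuallyEq.symm ((eventually_gt_atTop 0).mono key)) ?_
  refine tendsto_lintegral_filter_of_dominated_convergence
    ({z : p → ℝ | ∀ i, 0 < z i}.indicator fun z =>
      ENNReal.ofReal (Real.exp (-(z ⬝ᵥ R.mulVec c))) * ∫⁻ y, g y) ?_ ?_ ?_ ?_
  · refine Eventually.of_forall fun u => Measurable.indicator ?_ hpos
    refine Measurable.mul (Measurable.fun_mul ?_ ?_) ?_
    · exact (Real.measurable_exp.comp hdotm.neg).ennreal_ofReal
    · exact (Real.measurable_exp.comp (((hquadm.const_mul _).neg).div_const 2)).ennreal_ofReal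
    · have := (hmeasG u).comp (measurable_const_smul (u⁻¹) (α := p → ℝ))
      simpa only [Function.comp_def, mulVec_smul] using this
  · refine Eventually.of_forall fun u => Eventually.of_forall fun z => ?_
    refine Set.indicator_le_indicator ?_
    refine mul_le_mul' ?_ (lintegral_mono fun y => ?_)
    · refine mul_le_of_le_one_right' ?_
      rw [ENNReal.ofReal_le_one, Real.exp_le_one_iff]
      have := hR0 z
      have : 0 ≤ (u⁻¹) ^ 2 * (z ⬝ᵥ R.mulVec z) := by positivity
      linarith
    · by_cases h : y + u⁻¹ • K.mulVec z ∈ F u <;> simp [h]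
  · rw [lintegral_indicator hpos, lintegral_mul_const' _ _ hfin]
    exact ENNReal.mul_ne_top hZ hfin
  · refine Eventually.of_forall fun z => ?_
    by_cases hz : z ∈ {z : p → ℝ | ∀ i, 0 < z i}
    · simp only [Set.indicator_of_mem hz]
      have t1 := inner_tendsto g hg hfin F F0 hF hF0 hae (K.mulVec z)
      have t2 : Tendsto (fun u : ℝ => ENNReal.ofReal (Real.exp (-(z ⬝ᵥ R.mulVec c))) *
          ENNReal.ofReal (Real.exp (-((u⁻¹) ^ 2 * (z ⬝ᵥ R.mulVec z)) / 2))) atTop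
          (𝓝 (ENNReal.ofReal (Real.exp (-(z ⬝ᵥ R.mulVec c))))) := by
        have t3 : Tendsto (fun u : ℝ => Real.exp (-((u⁻¹) ^ 2 * (z ⬝ᵥ R.mulVec z)) / 2)) atTop
          (𝓝 1) := by
          have t4 : Tendsto (fun u : ℝ => u⁻¹) atTop (𝓝 0) := tendsto_inv_atTop_zero
          have := (Real.continuous_exp.tendsto _).comp
            ((((t4.pow 2).mul_const (z ⬝ᵥ R.mulVec z)).neg).div_const 2)
          simpa [Function.comp_def] using this
        have := ENNReal.Tendsto.const_mul (a := ENNReal.ofReal (Real.exp (-(z ⬝ᵥ R.mulVec c))))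
          ((ENNReal.continuous_ofReal.tendsto _).comp t3) (Or.inr ENNReal.ofReal_ne_top)
        simpa [Function.comp_def] using this
      refine ENNReal.Tendsto.mul t2 (Or.inl ?_) t1 (Or.inr ENNReal.ofReal_ne_top)
      simpa using Real.exp_pos _
    · simp only [Set.indicator_of_notMem hz]
      exact tendsto_const_nhds

lemma block_quad {p q : Type*} [Fintype p] [Fintype q] [DecidableEq p] [DecidableEq q]
    (A11 : Matrix p p ℝ) (B : Matrix p q ℝ) (D : Matrix q q ℝ)
    (h : (fromBlocks A11 B Bᴴ D).PosDef) :
    A11.PosDef ∧ (D - Bᴴ * A11⁻¹ * B).PosDef ∧ ∀ (a : p → ℝ) (b : q → ℝ),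
      Sum.elim a b ⬝ᵥ (fromBlocks A11 B Bᴴ D)⁻¹.mulVec (Sum.elim a b) =
        a ⬝ᵥ A11⁻¹.mulVec a + (b - (Bᴴ * A11⁻¹).mulVec a) ⬝ᵥ
          (D - Bᴴ * A11⁻¹ * B)⁻¹.mulVec (b - (Bᴴ * A11⁻¹).mulVec a) := by
  have h1 : A11.PosDef := by
    have := h.submatrix (e := (Sum.inl : p → p ⊕ q)) Sum.inl_injective
    exact this
  have hD : D.IsHermitian := by
    have := (h.submatrix (e := (Sum.inr : q → p ⊕ q)) Sum.inr_injective).1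
    exact this
  have : Invertible A11 := h1.isUnit.invertible
  have hS : (D - Bᴴ * A11⁻¹ * B).PosDef := by
    refine PosDef.of_dotProduct_mulVec_pos ?_ fun y hy => ?_
    · exact hD.sub (isHermitian_conjTranspose_mul_mul B h1.1.inv)
    · have e := schur_complement_eq₁₁ B D (-((A11⁻¹ * B).mulVec y)) y h1.1
      rw [neg_add_cancel, dotProduct_zero, zero_add] at e
      rw [dotProduct_mulVec, ← e, ← dotProduct_mulVec]
      refine h.dotProduct_mulVec_pos fun h0 => hy ?_
      funext j
      exact congrFun h0 (Sum.inr j)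
  refine ⟨h1, hS, fun a b => ?_⟩
  set S := D - Bᴴ * A11⁻¹ * B with hSdef
  set M := fromBlocks A11 B Bᴴ D with hM
  have hMdet : IsUnit M.det := (Matrix.isUnit_iff_isUnit_det _).1 h.isUnit
  have h1det : IsUnit A11.det := (Matrix.isUnit_iff_isUnit_det _).1 h1.isUnit
  have hSdet : IsUnit S.det := (Matrix.isUnit_iff_isUnit_det _).1 hS.isUnit
  obtain ⟨w, hw⟩ : ∃ w, M.mulVec w = Sum.elim a b :=
    ⟨M⁻¹.mulVec (Sum.elim a b), by rw [mulVec_mulVec, mul_nonsing_inv _ hMdet, one_mulVec]⟩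
  obtain ⟨w1, w2, rfl⟩ : ∃ w1 w2, w = Sum.elim w1 w2 :=
    ⟨w ∘ Sum.inl, w ∘ Sum.inr, (Sum.elim_comp_inl_inr w).symm⟩
  have hab := hw
  rw [hM, fromBlocks_mulVec] at hab
  have ha : a = A11.mulVec w1 + B.mulVec w2 := by
    funext i; exact (congrFun hab (Sum.inl i)).symm
  have hb : b = Bᴴ.mulVec w1 + D.mulVec w2 := by
    funext i; exact (congrFun hab (Sum.inr i)).symm
  have ea : A11⁻¹.mulVec a = w1 + (A11⁻¹ * B).mulVec w2 := by
    rw [ha, mulVec_add, mulVec_mulVec, mulVec_mulVec, nonsing_inv_mul _ h1det, one_mulVec]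
  have eb : b - (Bᴴ * A11⁻¹).mulVec a = S.mulVec w2 := by
    rw [← mulVec_mulVec, ea, hb, hSdef, sub_mulVec, mulVec_add, mulVec_mulVec, Matrix.mul_assoc]
    abel
  have ea' : a = A11.mulVec (w1 + (A11⁻¹ * B).mulVec w2) := by
    rw [← ea, mulVec_mulVec, mul_nonsing_inv _ h1det, one_mulVec]
  rw [eb, mulVec_mulVec, nonsing_inv_mul _ hSdet, one_mulVec, ea, ← hw, mulVec_mulVec,
    nonsing_inv_mul _ hMdet, one_mulVec, dotProduct_comm, dotProduct_comm a, ea',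
    dotProduct_comm (S.mulVec w2)]
  have e := schur_complement_eq₁₁ B D w1 w2 h1.1
  simp only [star_trivial, ← dotProduct_mulVec] at e
  exact e

/-- The splitting of an index type along a finset. -/
def splitE {ι : Type*} [Fintype ι] [DecidableEq ι] (I : Finset ι) : ↥I ⊕ ↥Iᶜ ≃ ι where
  toFun := Sum.elim Subtype.val Subtype.val
  invFun i := if h : i ∈ I then Sum.inl ⟨i, h⟩ else Sum.inr ⟨i, Finset.mem_compl.2 h⟩
  left_inv := by
    rintro (⟨i, hi⟩ | ⟨i, hi⟩)
    · simp [hi]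
    · simp [Finset.mem_compl.1 hi]
  right_inv := by
    intro i
    by_cases h : i ∈ I <;> simp [h]

lemma split_quad {ι : Type*} [Fintype ι] [DecidableEq ι] (I : Finset ι) (A : Matrix ι ι ℝ)
    (hA : A.PosDef) :
    (subM A I I).PosDef ∧ (schurC A I).PosDef ∧ ∀ x : ι → ℝ,
      x ⬝ᵥ A⁻¹.mulVec x = (fun i : ↥I => x i) ⬝ᵥ (subM A I I)⁻¹.mulVec (fun i : ↥I => x i) +
        ((fun j : ↥Iᶜ => x j) - (subM A Iᶜ I * (subM A I I)⁻¹).mulVec (fun i : ↥I => x i)) ⬝ᵥ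
          (schurC A I)⁻¹.mulVec ((fun j : ↥Iᶜ => x j) -
            (subM A Iᶜ I * (subM A I I)⁻¹).mulVec (fun i : ↥I => x i)) := by
  have hC : subM A Iᶜ I = (subM A I Iᶜ)ᴴ := by
    ext i j
    have := congrFun (congrFun hA.1 (i : ι)) (j : ι)
    simpa [subM, conjTranspose_apply] using this.symm
  have hM : A.submatrix (splitE I) (splitE I) =
      fromBlocks (subM A I I) (subM A I Iᶜ) (subM A I Iᶜ)ᴴ (subM A Iᶜ Iᶜ) := by
    rw [← hC]
    ext (i | i) (j | j) <;> rfl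
  have hP := hA.submatrix (e := splitE I) (splitE I).injective
  rw [hM] at hP
  obtain ⟨h1, h2, h3⟩ := block_quad _ _ _ hP
  rw [schurC, hC]
  refine ⟨h1, h2, fun x => ?_⟩
  rw [← h3, ← hM, inv_submatrix_equiv, submatrix_mulVec_equiv]
  have hx : Sum.elim (fun i : ↥I => x i) (fun j : ↥Iᶜ => x j) = x ∘ splitE I := by
    ext (i | i) <;> rfl
  rw [hx, comp_equiv_dotProduct_comp_equiv]
  congr 2
  ext i; simp

lemma split_measure {ι : Type*} [Fintype ι] [DecidableEq ι] (I : Finset ι) :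
    ∃ Φ : ((↥I → ℝ) × (↥Iᶜ → ℝ)) ≃ᵐ (ι → ℝ), MeasurePreserving Φ volume volume ∧
      ∀ ab, (fun i : ↥I => Φ ab i) = ab.1 ∧ (fun j : ↥Iᶜ => Φ ab j) = ab.2 := by
  refine ⟨(MeasurableEquiv.sumPiEquivProdPi (fun _ => ℝ)).symm.trans
    (MeasurableEquiv.piCongrLeft (fun _ : ι => ℝ) (splitE I)), ?_, ?_⟩
  · exact (volume_measurePreserving_piCongrLeft (fun _ : ι => ℝ) (splitE I)).comp
      (volume_measurePreserving_sumPiEquivProdPi_symm (fun _ : ↥I ⊕ ↥Iᶜ => ℝ))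
  · rintro ⟨a, b⟩
    constructor
    · funext i
      exact MeasurableEquiv.piCongrLeft_apply_apply (splitE I) (β := fun _ => ℝ)
        _ (Sum.inl i)
    · funext i
      exact MeasurableEquiv.piCongrLeft_apply_apply (splitE I) (β := fun _ => ℝ)
        _ (Sum.inr i)

/-- Gaussian normalising constant. -/
def kap {ι : Type*} [Fintype ι] [DecidableEq ι] (S : Matrix ι ι ℝ) : ℝ :=
  (Real.sqrt ((2 * Real.pi) ^ Fintype.card ι * S.det))⁻¹

lemma kap_pos {ι : Type*} [Fintype ι] [DecidableEq ι] (S : Matrix ι ι ℝ) (hS : S.PosDef) :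
    0 < kap S := by
  have := hS.det_pos
  unfold kap
  positivity

lemma gexp_meas {q : Type*} [Fintype q] (T : Matrix q q ℝ) :
    Measurable fun y : q → ℝ => ENNReal.ofReal (Real.exp (-(y ⬝ᵥ T.mulVec y) / 2)) := by
  have : Measurable fun z : q → ℝ => z ⬝ᵥ T.mulVec z :=
    (Continuous.dotProduct continuous_id
      (Continuous.matrix_mulVec continuous_const continuous_id)).measurable
  exact (Real.measurable_exp.comp ((this.neg).div_const 2)).ennreal_ofReal

lemma gauss_split {ι : Type*} [Fintype ι] [DecidableEq ι] (I : Finset ι) (A : Matrix ι ι ℝ)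
    (hA : A.PosDef) (h1 : (↥I → ℝ) → ℝ≥0∞) (h2 : (↥Iᶜ → ℝ) → ℝ≥0∞) (hh1 : Measurable h1)
    (hh2 : Measurable h2) :
    ∫⁻ x : ι → ℝ, h1 (fun i => x i) * h2 (fun j => x j) * ENNReal.ofReal (gaussPDF A x) =
      ENNReal.ofReal (kap A) * ∫⁻ a, h1 a *
        ENNReal.ofReal (Real.exp (-(a ⬝ᵥ (subM A I I)⁻¹.mulVec a) / 2)) *
        ∫⁻ b, h2 b * (fun y => ENNReal.ofReal (Real.exp (-(y ⬝ᵥ (schurC A I)⁻¹.mulVec y) / 2)))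
          (b - (subM A Iᶜ I * (subM A I I)⁻¹).mulVec a) := by
  obtain ⟨Φ, hΦ, hΦ'⟩ := split_measure I
  have hk := kap_pos A hA
  obtain ⟨-, -, hq⟩ := split_quad I A hA
  rw [← hΦ.lintegral_comp_emb Φ.measurableEmbedding]
  have e : ∀ ab : (↥I → ℝ) × (↥Iᶜ → ℝ), h1 (fun i => Φ ab i) * h2 (fun j => Φ ab j) *
      ENNReal.ofReal (gaussPDF A (Φ ab)) = ENNReal.ofReal (kap A) * (h1 ab.1 *
        ENNReal.ofReal (Real.exp (-(ab.1 ⬝ᵥ (subM A I I)⁻¹.mulVec ab.1) / 2)) *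
        (h2 ab.2 * (fun y => ENNReal.ofReal (Real.exp (-(y ⬝ᵥ (schurC A I)⁻¹.mulVec y) / 2)))
          (ab.2 - (subM A Iᶜ I * (subM A I I)⁻¹).mulVec ab.1))) := by
    intro ab
    rw [gaussPDF, hq, (hΦ' ab).1, (hΦ' ab).2, ENNReal.ofReal_mul (by exact hk.le), neg_add,
      add_div, Real.exp_add, ENNReal.ofReal_mul (Real.exp_nonneg _)]
    simp only [kap]
    ring
  simp only [e]
  have hm : Measurable fun ab : (↥I → ℝ) × (↥Iᶜ → ℝ) => ab.2 -
      (subM A Iᶜ I * (subM A I I)⁻¹).mulVec ab.1 :=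
    (Continuous.sub continuous_snd
      (Continuous.matrix_mulVec continuous_const continuous_fst)).measurable
  have hme : Measurable fun ab : (↥I → ℝ) × (↥Iᶜ → ℝ) => (h1 ab.1 *
        ENNReal.ofReal (Real.exp (-(ab.1 ⬝ᵥ (subM A I I)⁻¹.mulVec ab.1) / 2)) *
        (h2 ab.2 * (fun y => ENNReal.ofReal (Real.exp (-(y ⬝ᵥ (schurC A I)⁻¹.mulVec y) / 2)))
          (ab.2 - (subM A Iᶜ I * (subM A I I)⁻¹).mulVec ab.1))) := by
    refine Measurable.mul (Measurable.fun_mul (hh1.comp measurable_fst)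
      ((gexp_meas _).comp measurable_fst)) (Measurable.fun_mul (hh2.comp measurable_snd)
      ((gexp_meas _).comp hm))
  rw [lintegral_const_mul' _ _ ENNReal.ofReal_ne_top]
  congr 1
  rw [Measure.volume_eq_prod, lintegral_prod _ hme.aemeasurable]
  refine lintegral_congr fun a => ?_
  dsimp only
  refine lintegral_const_mul _ ?_
  refine Measurable.fun_mul hh2 ((gexp_meas _).comp (measurable_sub_const _))

lemma setLI_open_ne_zero {q : Type*} [Fintype q] (f : (q → ℝ) → ℝ≥0∞) (hf : Measurable f)
    (hpos : ∀ x, f x ≠ 0) (U : Set (q → ℝ)) (hU : IsOpen U) (hne : U.Nonempty) :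
    ∫⁻ y in U, f y ≠ 0 := by
  rw [← pos_iff_ne_zero, setLIntegral_pos_iff hf]
  have : Function.support f = Set.univ := by
    ext x; simp [hpos x]
  rw [this, Set.univ_inter]
  exact hU.measure_pos _ hne

lemma condNu_apply {ι : Type*} [Fintype ι] [DecidableEq ι] (A : Matrix ι ι ℝ) (I : Finset ι)
    (hA : A.PosDef) (F : Set (↥Iᶜ → ℝ)) (hF : MeasurableSet F) :
    condNu A I F = ENNReal.ofReal (kap (schurC A I)) *
      ∫⁻ y in F, ENNReal.ofReal (Real.exp (-(y ⬝ᵥ (schurC A I)⁻¹.mulVec y) / 2)) := by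
  have hk := kap_pos _ (split_quad I A hA).2.1
  rw [condNu, withDensity_apply _ hF, ← lintegral_const_mul' _ _ ENNReal.ofReal_ne_top]
  refine lintegral_congr fun y => ?_
  rw [← ENNReal.ofReal_mul hk.le]
  rfl

lemma gexp_fin {ι : Type*} [Fintype ι] [DecidableEq ι] (A : Matrix ι ι ℝ) (I : Finset ι)
    (hA : A.PosDef) (hfin : ∫⁻ x : ι → ℝ, ENNReal.ofReal (gaussPDF A x) ≠ ⊤) :
    ∫⁻ y : ↥Iᶜ → ℝ, ENNReal.ofReal (Real.exp (-(y ⬝ᵥ (schurC A I)⁻¹.mulVec y) / 2)) ≠ ⊤ := by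
  intro htop
  apply hfin
  have := gauss_split I A hA 1 1 measurable_one measurable_one
  simp only [Pi.one_apply, one_mul] at this
  rw [this]
  have e : ∀ a : ↥I → ℝ, ∫⁻ b : ↥Iᶜ → ℝ, (ENNReal.ofReal (Real.exp
      (-((b - (subM A Iᶜ I * (subM A I I)⁻¹).mulVec a) ⬝ᵥ (schurC A I)⁻¹.mulVec
        (b - (subM A Iᶜ I * (subM A I I)⁻¹).mulVec a)) / 2))) = ⊤ := by
    intro a
    rw [← htop]
    exact lintegral_sub_right_eq_self (fun y : ↥Iᶜ → ℝ => ENNReal.ofReal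
      (Real.exp (-(y ⬝ᵥ (schurC A I)⁻¹.mulVec y) / 2))) _
  simp only [e]
  have e2 : ∀ a : ↥I → ℝ, ENNReal.ofReal
      (Real.exp (-(a ⬝ᵥ (subM A I I)⁻¹.mulVec a) / 2)) * ⊤ = ⊤ := fun a =>
    ENNReal.mul_top (by simpa using Real.exp_pos _)
  simp only [e2]
  rw [lintegral_const, ENNReal.top_mul, ENNReal.mul_top]
  · simpa using kap_pos A hA
  · exact (isOpen_univ.measure_pos volume Set.univ_nonempty).ne'

lemma main_core {ι : Type*} [Fintype ι] [DecidableEq ι] (A : Matrix ι ι ℝ) (I : Finset ι)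
    (hA : A.PosDef) (hfin : ∫⁻ x : ι → ℝ, ENNReal.ofReal (gaussPDF A x) ≠ ⊤)
    (c : ι → ℝ) (hw : ∀ i : ↥I, 0 < (subM A I I)⁻¹.mulVec (subV c I) i) :
    ∃ C : ℝ → ℝ≥0∞, (∀ u, 0 < u → C u ≠ 0 ∧ C u ≠ ⊤) ∧
      ∀ (F : ℝ → Set (↥Iᶜ → ℝ)) (F0 : Set (↥Iᶜ → ℝ)) (_ : ∀ u, MeasurableSet (F u))
        (_ : MeasurableSet F0)
        (_ : ∀ᵐ y : ↥Iᶜ → ℝ, ∀ v : ↥Iᶜ → ℝ, ∀ᶠ u in atTop,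
          (y + (u:ℝ)⁻¹ • v ∈ F u ↔ y ∈ F0)),
        Tendsto (fun u => C u * (volume.withDensity fun x => ENNReal.ofReal (gaussPDF A x))
          {x : ι → ℝ | (∀ i : ↥I, c i * u < x i) ∧
            (fun j : ↥Iᶜ => x j - u * rowDot A c I j) ∈ F u}) atTop (𝓝 (condNu A I F0)) := by
  obtain ⟨h1, h2, -⟩ := split_quad I A hA
  have hk1 := kap_pos _ hA
  have hk2 := kap_pos _ h2
  set Z := ∫⁻ z in {z : ↥I → ℝ | ∀ i, 0 < z i},
        ENNReal.ofReal (Real.exp (-(z ⬝ᵥ (subM A I I)⁻¹.mulVec (subV c I)))) with hZ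
  have hZt : Z ≠ ⊤ := expDot_fin _ hw
  have hZ0 : Z ≠ 0 := by
    refine setLI_open_ne_zero _ ?_ ?_ _ ?_ ⟨fun _ => 1, fun _ => one_pos⟩
    · exact (Real.continuous_exp.comp
        (Continuous.dotProduct continuous_id continuous_const).neg).measurable.ennreal_ofReal
    · intro x
      simpa using Real.exp_pos _
    · simp only [Set.ofPred_forall]
      exact isOpen_iInter_of_finite fun i => isOpen_lt continuous_const (continuous_apply i)
  set ek := ENNReal.ofReal (kap A) with hek
  set es := ENNReal.ofReal (kap (schurC A I)) with hes
  have hek0 : ek ≠ 0 := by simpa [hek] using hk1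
  have hes0 : es ≠ 0 := by simpa [hes] using hk2
  have hekt : ek ≠ ⊤ := ENNReal.ofReal_ne_top
  have hest : es ≠ ⊤ := ENNReal.ofReal_ne_top
  refine ⟨fun u => (es * Z⁻¹) * ek⁻¹ * (ENNReal.ofReal (Real.exp
    (u ^ 2 * (subV c I ⬝ᵥ (subM A I I)⁻¹.mulVec (subV c I)) / 2)) *
        ENNReal.ofReal (u ^ Fintype.card ↥I)), ?_, ?_⟩
  · intro u hu
    have e1 : ENNReal.ofReal (Real.exp
      (u ^ 2 * (subV c I ⬝ᵥ (subM A I I)⁻¹.mulVec (subV c I)) / 2)) ≠ 0 := by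
      simpa using Real.exp_pos _
    have e2 : ENNReal.ofReal (u ^ Fintype.card ↥I) ≠ 0 := by
      rw [Ne, ENNReal.ofReal_eq_zero, not_le]; positivity
    constructor
    · exact mul_ne_zero (mul_ne_zero (mul_ne_zero hes0 (ENNReal.inv_ne_zero.2 hZt))
        (ENNReal.inv_ne_zero.2 hekt)) (mul_ne_zero e1 e2)
    · exact ENNReal.mul_ne_top (ENNReal.mul_ne_top (ENNReal.mul_ne_top hest
        (ENNReal.inv_ne_top.2 hZ0)) (ENNReal.inv_ne_top.2 hek0))
        (ENNReal.mul_ne_top ENNReal.ofReal_ne_top ENNReal.ofReal_ne_top)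
  intro F F0 hF hF0 hae
  have T := core_tendsto (subM A I I)⁻¹ h1.1.inv
    (fun z => by simpa using h1.inv.posSemidef.dotProduct_mulVec_nonneg z)
    (subM A Iᶜ I * (subM A I I)⁻¹) (subV c I) hw _ (gexp_meas (schurC A I)⁻¹)
    (gexp_fin A I hA hfin) F F0 hF hF0 hae
  have T2 := ENNReal.Tendsto.const_mul (a := es * Z⁻¹) T
    (Or.inr (ENNReal.mul_ne_top hest (ENNReal.inv_ne_top.2 hZ0)))
  rw [condNu_apply A I hA F0 hF0]
  rw [← hZ, mul_assoc es, ← mul_assoc Z⁻¹ Z, ENNReal.inv_mul_cancel hZ0 hZt, one_mul] at T2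
  refine T2.congr fun u => ?_
  have hmE1 : MeasurableSet {a : ↥I → ℝ | ∀ i, subV c I i * u < a i} := by measurability
  have hrow : ∀ j : ↥Iᶜ, rowDot A c I j =
      (subM A Iᶜ I * (subM A I I)⁻¹).mulVec (subV c I) j := by
    intro j
    rw [← mulVec_mulVec]
    rfl
  have hms : Measurable fun b : ↥Iᶜ → ℝ => b - u •
      (subM A Iᶜ I * (subM A I I)⁻¹).mulVec (subV c I) := measurable_sub_const _
  have hsub : ∀ x : ι → ℝ, (fun j : ↥Iᶜ => x j - u * rowDot A c I j) = (fun j : ↥Iᶜ => x j) -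
      u • (subM A Iᶜ I * (subM A I I)⁻¹).mulVec (subV c I) := by
    intro x; funext j; rw [hrow]; rfl
  have hmE : MeasurableSet {x : ι → ℝ | (∀ i : ↥I, c i * u < x i) ∧
            (fun j : ↥Iᶜ => x j - u * rowDot A c I j) ∈ F u} := by
    refine MeasurableSet.inter ?_ ?_
    · exact (measurable_pi_lambda (fun x : ι → ℝ => fun i : ↥I => x i)
        fun i => measurable_pi_apply _) hmE1
    · refine (measurable_pi_lambda (fun x : ι → ℝ => fun j : ↥Iᶜ => x j - u * rowDot A c I j)
        fun j => (measurable_pi_apply _).sub_const _) (hF u)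
  rw [withDensity_apply _ hmE, ← lintegral_indicator hmE]
  have G := gauss_split I A hA ({a : ↥I → ℝ | ∀ i, subV c I i * u < a i}.indicator 1)
    (fun b => (F u).indicator 1 (b - u • (subM A Iᶜ I * (subM A I I)⁻¹).mulVec (subV c I)))
    (measurable_one.indicator hmE1) ((measurable_one.indicator (hF u)).comp hms)
  have G2 : ∫⁻ x, {x : ι → ℝ | (∀ i : ↥I, c i * u < x i) ∧
            (fun j : ↥Iᶜ => x j - u * rowDot A c I j) ∈ F u}.indicator
            (fun x => ENNReal.ofReal (gaussPDF A x)) x =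
      ∫⁻ x : ι → ℝ, ({a : ↥I → ℝ | ∀ i, subV c I i * u < a i}.indicator 1 fun i => x i) *
        (F u).indicator 1 ((fun j : ↥Iᶜ => x j) -
          u • (subM A Iᶜ I * (subM A I I)⁻¹).mulVec (subV c I)) *
        ENNReal.ofReal (gaussPDF A x) := by
    refine lintegral_congr fun x => ?_
    rw [← hsub]
    by_cases hx1 : (fun i : ↥I => x i) ∈ {a : ↥I → ℝ | ∀ i, subV c I i * u < a i}
    · by_cases hx2 : (fun j : ↥Iᶜ => x j - u * rowDot A c I j) ∈ F u
      · have hx : x ∈ {x : ι → ℝ | (∀ i : ↥I, c i * u < x i) ∧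
            (fun j : ↥Iᶜ => x j - u * rowDot A c I j) ∈ F u} := ⟨hx1, hx2⟩
        rw [Set.indicator_of_mem hx1, Set.indicator_of_mem hx2, Set.indicator_of_mem hx]
        simp
      · rw [Set.indicator_of_notMem hx2, Set.indicator_of_notMem fun h => hx2 h.2]
        simp
    · rw [Set.indicator_of_notMem hx1, Set.indicator_of_notMem fun h => hx1 h.1]
      simp
  rw [G2, G, ← hek]
  dsimp only
  generalize (∫⁻ a : ↥I → ℝ, _) = W
  generalize ENNReal.ofReal (Real.exp _) = V
  generalize ENNReal.ofReal (u ^ _) = V2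
  have : ek⁻¹ * ek = 1 := ENNReal.inv_mul_cancel hek0 hekt
  calc es * Z⁻¹ * (V * (V2 * W)) = es * Z⁻¹ * (ek⁻¹ * ek) * (V * (V2 * W)) := by
        rw [this, mul_one]
    _ = _ := by ring

lemma ev_iff (t y v : ℝ) (h : y ≠ t) : ∀ᶠ u : ℝ in atTop, (t < y + u⁻¹ * v ↔ t < y) := by
  have T : Tendsto (fun u : ℝ => y + u⁻¹ * v) atTop (𝓝 y) := by
    have := (tendsto_inv_atTop_zero (𝕜 := ℝ)).mul_const v |>.const_add y
    simpa using this
  rcases lt_or_gt_of_ne h with h | h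
  · filter_upwards [T.eventually (gt_mem_nhds h)] with u hu
    exact ⟨fun h' => absurd h' hu.not_gt, fun h' => absurd h' h.not_gt⟩
  · filter_upwards [T.eventually (lt_mem_nhds h)] with u hu
    exact ⟨fun _ => h, fun _ => hu⟩

lemma ev_true (s y v : ℝ) (hs : s < 0) : ∀ᶠ u : ℝ in atTop, s * u < y + u⁻¹ * v := by
  have T : Tendsto (fun u : ℝ => y + u⁻¹ * v) atTop (𝓝 y) := by
    have := (tendsto_inv_atTop_zero (𝕜 := ℝ)).mul_const v |>.const_add y
    simpa using this
  have T2 : Tendsto (fun u : ℝ => s * u) atTop atBot := tendsto_id.const_mul_atTop_of_neg hs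
  filter_upwards [T.eventually (lt_mem_nhds (show y - 1 < y by linarith)),
    T2.eventually (eventually_lt_atBot (y - 1))] with u h1 h2
  exact h2.trans h1

/-- The image of a finset of a subtype is equivalent to it. -/
def imE {ι : Type*} [DecidableEq ι] {s : Finset ι} (I : Finset ↥s) :
    ↥I ≃ ↥(I.image Subtype.val) :=
  Equiv.ofBijective (fun i => ⟨(i : ↥s), Finset.mem_image_of_mem _ i.2⟩) (by
    constructor
    · intro i j h
      have : ((i : ↥s) : ι) = ((j : ↥s) : ι) := by simpa using h
      exact Subtype.ext (Subtype.ext this)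
    · rintro ⟨i, hi⟩
      obtain ⟨j, hj, rfl⟩ := Finset.mem_image.1 hi
      exact ⟨⟨j, hj⟩, rfl⟩)

lemma im_w {ι : Type*} [Fintype ι] [DecidableEq ι] (A : Matrix ι ι ℝ) (c : ι → ℝ)
    {s : Finset ι} (I : Finset ↥s) :
    (subM (subM A s s) I I)⁻¹.mulVec (subV (subV c s) I) =
      (subM A (I.image Subtype.val) (I.image Subtype.val))⁻¹.mulVec
        (subV c (I.image Subtype.val)) ∘ imE I := by
  have h1 : subM (subM A s s) I I =
      (subM A (I.image Subtype.val) (I.image Subtype.val)).submatrix (imE I) (imE I) := rfl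
  have h2 : subV (subV c s) I = subV c (I.image Subtype.val) ∘ imE I := rfl
  rw [h1, h2, inv_submatrix_equiv, submatrix_mulVec_equiv]
  congr 2
  ext i; simp

lemma im_row {ι : Type*} [Fintype ι] [DecidableEq ι] (A : Matrix ι ι ℝ) (c : ι → ℝ)
    {s : Finset ι} (I : Finset ↥s) (j : ↥s) :
    (fun i : ↥I => subM A s s j i) ⬝ᵥ
      (subM (subM A s s) I I)⁻¹.mulVec (subV (subV c s) I) =
      rowDot A c (I.image Subtype.val) j := by
  rw [im_w]
  exact comp_equiv_dotProduct_comp_equiv (fun i : ↥(I.image Subtype.val) => A j i) _ (imE I)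

/-- Theorem 2.2 (conditional limit): with `𝓘, 𝓛` the index sets of `Π_B(c_{-1})`, `B` the
covariance matrix of `X_{-1}`, `𝓘 = {k,...,d-1}`, `I = {k+1,...,d}` and
`c_1 = Σ_{1,I}(Σ_II)⁻¹c_I`, the conditional law of `X_1 - c_1 u` given `X_{-1} > c_{-1} u`
converges in distribution, as `u → ∞`, to `Y` with survival function
`Ḡ(x) = P(X_1 > x, X_{N*} > 0 | X_I = 0)/P(X_{N*} > 0 | X_I = 0)`, `N* = 𝓝 + 1`,
`𝓝 = 𝓛 \ 𝓘` (so that `Ḡ(x) = P(X_1 > x | X_I = 0)` when `𝓛 = 𝓘`). -/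
theorem mes_multivariate_gaussian_conditional_limit
    {Ω : Type*} [MeasurableSpace Ω] (P : Measure Ω) [IsProbabilityMeasure P]
    {d : ℕ} [NeZero d] (A : Matrix (Fin d) (Fin d) ℝ) (hA : A.PosDef)
    (hcorr : ∀ i, A i i = 1)
    (X : Ω → Fin d → ℝ) (hX : Measurable X) (hG : IsCenteredGaussianRV P X A)
    (c : Fin d → ℝ) (hb : ∃ i : ↥(offFirst d), 0 < c (i : Fin d))
    (btT : ↥(offFirst d) → ℝ) (calI calL : Finset ↥(offFirst d))
    (hsolB : IsQPSol (subM A (offFirst d) (offFirst d)) (subV c (offFirst d)) btT)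
    (hIB : IsQPIndex (subM A (offFirst d) (offFirst d)) (subV c (offFirst d)) btT calI)
    (hLB : ∀ i, i ∈ calL ↔ btT i = c (i : Fin d))
    (k : ℕ) (hk1 : 1 ≤ k) (hkd : k < d)
    (hIm : calI.image Subtype.val = Finset.univ.filter fun i : Fin d => k ≤ (i : ℕ))
    (hc1 : c 0 = rowDot A c (calI.image Subtype.val) 0) :
    ∀ x : ℝ,
      Tendsto (fun u =>
          (P ({ω | x + c 0 * u < X ω 0} ∩ tailEvent X c u)).toReal /
            (P (tailEvent X c u)).toReal) atTop
        (𝓝 (Gbar A (calI.image Subtype.val) ((calL \ calI).image Subtype.val) 0 x)) := by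
  intro x
  have hfin : ∫⁻ x : Fin d → ℝ, ENNReal.ofReal (gaussPDF A x) ≠ ⊤ := by
    have h : (Measure.map X P) Set.univ = 1 := by
      rw [Measure.map_apply hX MeasurableSet.univ, Set.preimage_univ, measure_univ]
    rw [hG, withDensity_apply _ MeasurableSet.univ, Measure.restrict_univ] at h
    rw [h]; exact ENNReal.one_ne_top
  obtain ⟨-, hIeq, hwB, hrowB⟩ := hIB
  obtain ⟨hfeas, -⟩ := hsolB
  set I := calI.image Subtype.val with hIdef
  set Ns := (calL \ calI).image Subtype.val with hNs
  have hI0 : ∀ i ∈ I, i ≠ 0 := by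
    intro i hi h0
    rw [hIm, Finset.mem_filter] at hi
    have := hi.2
    rw [h0] at this
    simp at this
    omega
  have hmemoff : ∀ j : Fin d, j ≠ 0 → j ∈ offFirst d := fun j hj => by simp [offFirst, hj]
  have hw : ∀ i : ↥I, 0 < (subM A I I)⁻¹.mulVec (subV c I) i := by
    intro i
    have h := hwB ((imE calI).symm i)
    rw [im_w] at h
    simpa using h
  have hbt : ∀ (j : Fin d) (hj : j ≠ 0), j ∉ I → btT ⟨j, hmemoff j hj⟩ = rowDot A c I j := by
    intro j hj hjI
    rw [hrowB ⟨j, hmemoff j hj⟩ (fun h => hjI (Finset.mem_image_of_mem _ h)), im_row]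
  have hNs1 : ∀ j ∈ Ns, j ≠ 0 ∧ j ∉ I ∧ c j = rowDot A c I j := by
    intro j hj
    obtain ⟨l, hl, rfl⟩ := Finset.mem_image.1 hj
    rw [Finset.mem_sdiff] at hl
    have h0 : (l : Fin d) ≠ 0 := (Finset.mem_filter.1 l.2).2
    have hnI : (l : Fin d) ∉ I := by
      intro h
      obtain ⟨m, hm, hml⟩ := Finset.mem_image.1 h
      exact hl.2 (Subtype.ext hml ▸ hm)
    exact ⟨h0, hnI, by rw [← hbt _ h0 hnI]; exact ((hLB l).1 hl.1).symm⟩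
  have hNs2 : ∀ j, j ≠ 0 → j ∉ I → j ∉ Ns → c j - rowDot A c I j < 0 := by
    intro j hj hjI hjN
    rw [← hbt j hj hjI, sub_neg]
    refine lt_of_le_of_ne (hfeas ⟨j, hmemoff j hj⟩) fun h => hjN ?_
    refine Finset.mem_image.2 ⟨⟨j, hmemoff j hj⟩, Finset.mem_sdiff.2 ⟨(hLB _).2 h.symm, ?_⟩, rfl⟩
    exact fun h => hjI (Finset.mem_image_of_mem _ h)
  obtain ⟨C, hC, hT⟩ := main_core A I hA hfin c hw
  have hev : ∀ (y : ↥Iᶜ → ℝ), (∀ j, y j ≠ 0) → ∀ v : ↥Iᶜ → ℝ, ∀ᶠ u : ℝ in atTop,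
      (y + u⁻¹ • v ∈ {y : ↥Iᶜ → ℝ | ∀ j : ↥Iᶜ, (j : Fin d) ≠ 0 →
        (c j - rowDot A c I j) * u < y j} ↔
        y ∈ {y : ↥Iᶜ → ℝ | ∀ j : ↥Iᶜ, (j : Fin d) ∈ Ns → 0 < y j}) := by
    intro y hy v
    have : ∀ j : ↥Iᶜ, ∀ᶠ u : ℝ in atTop, (((j : Fin d) ≠ 0 →
        (c j - rowDot A c I j) * u < y j + u⁻¹ * v j) ↔ ((j : Fin d) ∈ Ns → 0 < y j)) := by
      intro j
      have hjI : (j : Fin d) ∉ I := Finset.mem_compl.1 j.2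
      by_cases hN : (j : Fin d) ∈ Ns
      · obtain ⟨h0, -, h1⟩ := hNs1 j hN
        filter_upwards [ev_iff 0 (y j) (v j) (hy j)] with u hu
        rw [← h1, sub_self, zero_mul, hu]
        simp [h0, hN]
      · by_cases h0 : (j : Fin d) = 0
        · exact Eventually.of_forall fun u => ⟨fun _ h => absurd h hN, fun _ h => absurd h0 h⟩
        · filter_upwards [ev_true _ (y j) (v j) (hNs2 j h0 hjI hN)] with u hu
          simp [hN, hu]
    filter_upwards [eventually_all.2 this] with u hu
    exact forall_congr' hu
  have hmF : ∀ u : ℝ, MeasurableSet {y : ↥Iᶜ → ℝ | ∀ j : ↥Iᶜ, (j : Fin d) ≠ 0 →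
        (c j - rowDot A c I j) * u < y j} := by
    intro u
    simp only [Set.ofPred_forall]
    exact MeasurableSet.iInter fun j => MeasurableSet.iInter fun _ =>
      measurableSet_lt measurable_const (measurable_pi_apply j)
  have hoF0 : IsOpen {y : ↥Iᶜ → ℝ | ∀ j : ↥Iᶜ, (j : Fin d) ∈ Ns → 0 < y j} := by
    simp only [Set.ofPred_forall]
    exact isOpen_iInter_of_finite fun j => isOpen_iInter_of_finite fun _ =>
      isOpen_lt continuous_const (continuous_apply j)
  have hmX : MeasurableSet {y : ↥Iᶜ → ℝ | ∀ j : ↥Iᶜ, (j : Fin d) = 0 → x < y j} := by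
    simp only [Set.ofPred_forall]
    exact MeasurableSet.iInter fun j => MeasurableSet.iInter fun _ =>
      measurableSet_lt measurable_const (measurable_pi_apply j)
  have hae : ∀ t : ℝ, ∀ᵐ y : ↥Iᶜ → ℝ, ∀ j, y j ≠ t := fun t =>
    ae_all_iff.2 fun j => Measure.ae_eval_ne (μ := fun _ : ↥Iᶜ => (volume : Measure ℝ)) j t
  have TD := hT _ _ hmF hoF0.measurableSet (by
    filter_upwards [hae 0] with y hy
    exact hev y hy)
  have TN := hT (fun u => {y : ↥Iᶜ → ℝ | ∀ j : ↥Iᶜ, (j : Fin d) = 0 → x < y j} ∩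
      {y : ↥Iᶜ → ℝ | ∀ j : ↥Iᶜ, (j : Fin d) ≠ 0 → (c j - rowDot A c I j) * u < y j})
    ({y : ↥Iᶜ → ℝ | ∀ j : ↥Iᶜ, (j : Fin d) = 0 → x < y j} ∩
      {y : ↥Iᶜ → ℝ | ∀ j : ↥Iᶜ, (j : Fin d) ∈ Ns → 0 < y j})
    (fun u => hmX.inter (hmF u)) (hmX.inter hoF0.measurableSet) (by
      filter_upwards [hae 0, hae x] with y hy hy' v
      have : ∀ j : ↥Iᶜ, ∀ᶠ u : ℝ in atTop, (((j : Fin d) = 0 → x < y j + u⁻¹ * v j) ↔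
          ((j : Fin d) = 0 → x < y j)) := by
        intro j
        filter_upwards [ev_iff x (y j) (v j) (hy' j)] with u hu
        rw [hu]
      filter_upwards [eventually_all.2 this, hev y hy v] with u h1 h2
      exact and_congr (forall_congr' h1) h2)
  have hiff : ∀ (u : ℝ) (z : Fin d → ℝ), (∀ i : Fin d, i ≠ 0 → c i * u < z i) ↔
      ((∀ i : ↥I, c i * u < z i) ∧ ∀ j : ↥Iᶜ, (j : Fin d) ≠ 0 →
        (c j - rowDot A c I j) * u < z j - u * rowDot A c I j) := by
    intro u z
    constructor
    · intro h
      refine ⟨fun i => h i (hI0 i i.2), fun j hj => ?_⟩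
      have := h j hj
      linarith
    · rintro ⟨h1, h2⟩ i hi
      by_cases hiI : i ∈ I
      · exact h1 ⟨i, hiI⟩
      · have := h2 ⟨i, Finset.mem_compl.2 hiI⟩ hi
        dsimp only at this
        linarith
  have h0I : (0 : Fin d) ∉ I := fun h => hI0 0 h rfl
  have hmap : ∀ E : Set (Fin d → ℝ), MeasurableSet E → P (X ⁻¹' E) =
      (volume.withDensity fun x => ENNReal.ofReal (gaussPDF A x)) E := by
    intro E hE
    rw [← Measure.map_apply hX hE, hG]
  have hmE : ∀ (F : Set (↥Iᶜ → ℝ)) (u : ℝ), MeasurableSet F →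
      MeasurableSet {z : Fin d → ℝ | (∀ i : ↥I, c i * u < z i) ∧
            (fun j : ↥Iᶜ => z j - u * rowDot A c I j) ∈ F} := by
    intro F u hF
    have hm1 : MeasurableSet {z : Fin d → ℝ | ∀ i : ↥I, c i * u < z i} := by
      simp only [Set.ofPred_forall]
      exact MeasurableSet.iInter fun j => measurableSet_lt measurable_const (measurable_pi_apply _)
    refine MeasurableSet.inter hm1 ?_
    · refine (measurable_pi_lambda (fun x : Fin d → ℝ => fun j : ↥Iᶜ => x j - u * rowDot A c I j)
        fun j => (measurable_pi_apply _).sub_const _) hF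
  have eD : ∀ u : ℝ, (volume.withDensity fun x => ENNReal.ofReal (gaussPDF A x))
      {z : Fin d → ℝ | (∀ i : ↥I, c i * u < z i) ∧
        (fun j : ↥Iᶜ => z j - u * rowDot A c I j) ∈ {y : ↥Iᶜ → ℝ | ∀ j : ↥Iᶜ, (j : Fin d) ≠ 0 →
        (c j - rowDot A c I j) * u < y j}} = P (tailEvent X c u) := by
    intro u
    rw [← hmap _ (hmE _ u (hmF u))]
    congr 1
    ext ω
    exact (hiff u (X ω)).symm
  have eN : ∀ u : ℝ, (volume.withDensity fun x => ENNReal.ofReal (gaussPDF A x))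
      {z : Fin d → ℝ | (∀ i : ↥I, c i * u < z i) ∧
        (fun j : ↥Iᶜ => z j - u * rowDot A c I j) ∈
        {y : ↥Iᶜ → ℝ | ∀ j : ↥Iᶜ, (j : Fin d) = 0 → x < y j} ∩
        {y : ↥Iᶜ → ℝ | ∀ j : ↥Iᶜ, (j : Fin d) ≠ 0 →
        (c j - rowDot A c I j) * u < y j}} =
      P ({ω | x + c 0 * u < X ω 0} ∩ tailEvent X c u) := by
    intro u
    rw [← hmap _ (hmE _ u (hmX.inter (hmF u)))]
    congr 1
    ext ω
    have hx : (∀ j : ↥Iᶜ, (j : Fin d) = 0 → x < X ω j - u * rowDot A c I j) ↔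
        x + c 0 * u < X ω 0 := by
      constructor
      · intro h
        have := h ⟨0, Finset.mem_compl.2 h0I⟩ rfl
        dsimp only at this
        rw [← hc1] at this
        linarith
      · rintro h ⟨j, hj⟩ hj0
        dsimp only at hj0 ⊢
        subst hj0
        rw [← hc1]
        linarith
    have hh := hiff u (X ω)
    constructor
    · rintro ⟨a1, a2, a3⟩
      exact ⟨hx.1 a2, hh.2 ⟨a1, a3⟩⟩
    · rintro ⟨a1, a2⟩
      exact ⟨(hh.1 a2).1, hx.2 a1, (hh.1 a2).2⟩
  simp only [eD] at TD
  simp only [eN] at TN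
  have hS := (split_quad I A hA).2.1
  have hg := gexp_fin A I hA hfin
  have hDne0 : condNu A I {y : ↥Iᶜ → ℝ | ∀ j : ↥Iᶜ, (j : Fin d) ∈ Ns → 0 < y j} ≠ 0 := by
    rw [condNu_apply A I hA _ hoF0.measurableSet]
    refine mul_ne_zero (by simpa using kap_pos _ hS) ?_
    refine setLI_open_ne_zero _ (gexp_meas _) (fun y => by simpa using Real.exp_pos _) _ hoF0
      ⟨fun _ => 1, fun _ _ => one_pos⟩
  have hfinNu : ∀ F : Set (↥Iᶜ → ℝ), MeasurableSet F → condNu A I F ≠ ⊤ := by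
    intro F hF
    rw [condNu_apply A I hA _ hF]
    exact ENNReal.mul_ne_top ENNReal.ofReal_ne_top
      (ne_top_of_le_ne_top hg (setLIntegral_le_lintegral _ _))
  have RD := (ENNReal.tendsto_toReal (hfinNu _ hoF0.measurableSet)).comp TD
  have RN := (ENNReal.tendsto_toReal (hfinNu _ (hmX.inter hoF0.measurableSet))).comp TN
  have R := RN.div RD (ENNReal.toReal_ne_zero.2 ⟨hDne0, hfinNu _ hoF0.measurableSet⟩)
  have hGb : Gbar A I Ns 0 x = (condNu A I
      ({y : ↥Iᶜ → ℝ | ∀ j : ↥Iᶜ, (j : Fin d) = 0 → x < y j} ∩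
        {y : ↥Iᶜ → ℝ | ∀ j : ↥Iᶜ, (j : Fin d) ∈ Ns → 0 < y j})).toReal /
      (condNu A I {y : ↥Iᶜ → ℝ | ∀ j : ↥Iᶜ, (j : Fin d) ∈ Ns → 0 < y j}).toReal := rfl
  rw [hGb]
  refine R.congr' ?_
  filter_upwards [eventually_gt_atTop 0] with u hu
  have hCu : (C u).toReal ≠ 0 := ENNReal.toReal_ne_zero.2 (hC u hu)
  simp only [Function.comp_apply, Pi.div_apply, ENNReal.toReal_mul]
  exact mul_div_mul_left _ _ hCu
end
end
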